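/- arXiv:math/0508011 — 3 statements merged into one kernel-verified Lean document; each statement's English description precedes it below -/
import Mathlib

section
/- For every n ≥ 2 and 0 < p < n, the boundary manifold ℛ_{p,0} ⊆ Matrix (Fin n) (Fin n) ℂ is path-connected and its fundamental group at any basepoint is isomorphic to ℤ/2: for every x ∈ ℛ_{p,0} there is a group isomorphism FundamentalGroup ℛ_{p,0} x ≃* ZMod 2. -/
open Matrix
open scoped ComplexOrder

/-- The stratum `ℛ_{p,0}` of the boundary of the Lie ball: symmetric complex `n×n`
matrices `z` with `1 − z·z̄` positive semidefinite of rank `p`. -/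
def lieBallBoundary (n p : ℕ) : Set (Matrix (Fin n) (Fin n) ℂ) :=
  {z | zᵀ = z ∧ (1 - z * z.map (starRingEnd ℂ)).PosSemidef ∧
    (1 - z * z.map (starRingEnd ℂ)).rank = p}

namespace LieBall
open Set Topology unitInterval

/-- A square whose left side is `p` and whose right side is constant. -/
lemma loop_null_of_contract {X : Type*} [TopologicalSpace X] {x : X} (p : Path x x)
    (H : C(I × I, X)) (a : X) (h0 : ∀ t, H (0, t) = p t) (h1 : ∀ t, H (1, t) = a)
    (hs : ∀ s, H (s, 0) = H (s, 1)) : p.Homotopic (Path.refl x) := by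
  -- paths in the square
  let b : Path ((0, 0) : I × I) (0, 1) :=
    ⟨⟨fun t => (0, t), by fun_prop⟩, rfl, rfl⟩
  let l : Path ((0, 0) : I × I) (1, 0) := ⟨⟨fun t => (t, 0), by fun_prop⟩, rfl, rfl⟩
  let r : Path ((0, 1) : I × I) (1, 1) := ⟨⟨fun t => (t, 1), by fun_prop⟩, rfl, rfl⟩
  let u : Path ((1, 0) : I × I) (1, 1) := ⟨⟨fun t => (1, t), by fun_prop⟩, rfl, rfl⟩
  have : ContractibleSpace (I × I) := by
    have h : ContractibleSpace I := (convex_Icc (0:ℝ) 1).contractibleSpace ⟨0, by simp⟩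
    obtain ⟨e⟩ := h.hequiv_unit
    exact ⟨⟨(e.prodCongr e).trans (Homeomorph.punitProd Unit).toHomotopyEquiv⟩⟩
  have key : b.Homotopic ((l.trans u).trans r.symm) := SimplyConnectedSpace.paths_homotopic _ _
  have key2 := key.map H
  rw [Path.map_trans, Path.map_trans, ← Path.map_symm] at key2
  have e0 : x = H (0, 0) := by rw [h0]; simp
  have e1 : x = H (0, 1) := by rw [h0]; simp
  have ea : a = H (1, 0) := by rw [h1]
  have ea' : a = H (1, 1) := by rw [h1]
  let l' : Path x a := (l.map H.continuous).cast e0 ea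
  have hl : (l.map H.continuous) = l'.cast e0.symm ea.symm := by ext; rfl
  have hr : (r.map H.continuous) = l'.cast e1.symm ea'.symm := by
    ext t; exact (hs t).symm
  have hu : (u.map H.continuous) = (Path.refl a).cast ea.symm ea'.symm := by
    ext t; exact h1 t
  have hb : (b.map H.continuous) = p.cast e0.symm e1.symm := by
    ext t; exact h0 t
  have key3 := key2.pathCast e0 e1
  have hp : p = (b.map H.continuous).cast e0 e1 := by ext t; exact (h0 t).symm
  rw [← hp, hl, hu, hr] at key3
  have : (((l'.cast e0.symm ea.symm).trans ((Path.refl a).cast ea.symm ea'.symm)).trans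
      (l'.cast e1.symm ea'.symm).symm).cast e0 e1 = (l'.trans (Path.refl a)).trans l'.symm := by
    ext t; simp only [Path.cast_coe, Path.trans_apply, Path.symm_apply]
  rw [this] at key3
  refine key3.trans ?_
  rw [← Path.Homotopic.Quotient.eq]
  simp

/-- Smooth approximation of paths in an open set, with straight-line homotopy inside. -/
lemma smooth_approx {E : Type*} [NormedAddCommGroup E] [NormedSpace ℝ E]
    {W : Set E} (hW : IsOpen W) (f : C(I, E)) (hf : ∀ t, f t ∈ W) :
    ∃ c : ℝ → E, ContDiff ℝ 1 c ∧ c 0 = f 0 ∧ c 1 = f 1 ∧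
      ∀ t : I, ∀ s ∈ Icc (0:ℝ) 1, (1 - s) • f t + s • c t ∈ W := by
  obtain ⟨δ, hδ, hth⟩ := (isCompact_range f.continuous).exists_thickening_subset_open hW
    (by rintro _ ⟨t, rfl⟩; exact hf t)
  have hlim := bernsteinApproximation_uniform f
  rw [Metric.tendsto_atTop] at hlim
  obtain ⟨N, hN⟩ := hlim δ hδ
  have hN := hN (N+1) (by omega)
  let c : ℝ → E := fun x => ∑ k : Fin (N+1+1),
    (((N+1).choose k : ℝ) * x ^ (k:ℕ) * (1 - x) ^ (N + 1 - k)) • f (bernstein.z k)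
  have hc : ∀ t : I, c t = bernsteinApproximation (N+1) f t := by
    intro t
    rw [bernsteinApproximation.apply]
    simp [c, bernstein_apply]
  refine ⟨c, ?_, ?_, ?_, ?_⟩
  · unfold c; fun_prop
  · have := hc 0
    rw [bernsteinApproximation.apply_zero] at this
    simpa using this
  · have := hc 1
    rw [bernsteinApproximation.apply_one (by omega)] at this
    simpa using this
  · intro t s hs
    apply hth
    rw [Metric.mem_thickening_iff]
    refine ⟨f t, mem_range_self _, ?_⟩
    have h1 : dist (c t) (f t) < δ := by
      rw [hc]
      exact lt_of_le_of_lt (ContinuousMap.dist_apply_le_dist t) hN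
    have : (1 - s) • f t + s • c t - f t = s • (c t - f t) := by module
    rw [dist_eq_norm, this, norm_smul, Real.norm_of_nonneg hs.1, ← dist_eq_norm]
    calc s * dist (c t) (f t) ≤ 1 * dist (c t) (f t) := by gcongr; exact hs.2
      _ < δ := by simpa using h1

lemma simplyConnected_of_genericCone {E : Type*} [NormedAddCommGroup E] [NormedSpace ℝ E]
    {W : Set E} (hW : IsOpen W) (hne : W.Nonempty)
    (gp : ∀ c : ℝ → E, ContDiff ℝ 1 c → ∃ a : E, ∀ t, c t ∈ W → ∀ s ∈ Icc (0:ℝ) 1,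
      (1 - s) • c t + s • a ∈ W) : SimplyConnectedSpace W := by
  rw [simply_connected_iff_loops_nullhomotopic]
  constructor
  · rw [← isPathConnected_iff_pathConnectedSpace]
    obtain ⟨x, hx⟩ := hne
    refine ⟨x, hx, fun {y} hy => ?_⟩
    obtain ⟨a, ha⟩ := gp (fun t => (1 - t) • x + t • y) (by fun_prop)
    have hseg : ∀ z : E, (∀ s ∈ Icc (0:ℝ) 1, (1 - s) • z + s • a ∈ W) → JoinedIn W z a := by
      intro z hz
      refine ⟨⟨⟨fun s => (1 - (s:ℝ)) • z + (s:ℝ) • a, by fun_prop⟩, by simp, by simp⟩, ?_⟩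
      intro s; exact hz s s.2
    have h0 := ha 0
    have h1 := ha 1
    simp only [sub_zero, one_smul, zero_smul, add_zero, sub_self, zero_add] at h0 h1
    exact (hseg x (h0 hx)).trans (hseg y (h1 hy)).symm
  · intro x γ
    let f : C(I, E) := ⟨fun t => (γ t : E), by fun_prop⟩
    obtain ⟨c, hc, hc0, hc1, hcW⟩ := smooth_approx hW f (fun t => (γ t).2)
    have hc0' : c 0 = x := by rw [hc0]; simp [f]
    have hc1' : c 1 = x := by rw [hc1]; simp [f]
    have hcc : ∀ t : I, c t ∈ W := fun t => by simpa using hcW t 1 (by simp)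
    have hcont := hc.continuous
    let γ' : Path x x := ⟨⟨fun t => ⟨c t, hcc t⟩, by fun_prop⟩, by
      apply Subtype.ext; simpa using hc0', by apply Subtype.ext; simpa using hc1'⟩
    have h1 : γ.Homotopic γ' := by
      refine ⟨⟨⟨⟨fun z => ⟨(1 - (z.1:ℝ)) • (γ z.2 : E) + (z.1:ℝ) • c z.2, hcW z.2 z.1 z.1.2⟩, by fun_prop⟩, ?_, ?_⟩, ?_⟩⟩
      · intro t; apply Subtype.ext; simp
      · intro t; apply Subtype.ext; simp [γ']
      · intro s t ht
        apply Subtype.ext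
        rcases ht with rfl | ht
        · simp [hc0', ← add_smul]
        · rw [mem_singleton_iff] at ht
          subst ht
          simp [hc1', ← add_smul]
    refine h1.trans ?_
    obtain ⟨a, ha⟩ := gp c hc
    have haW : a ∈ W := by simpa using ha 0 (hcc 0) 1 (by simp)
    refine loop_null_of_contract γ' ⟨fun z => ⟨(1 - (z.1:ℝ)) • (c z.2 : E) + (z.1:ℝ) • a,
      ha _ (hcc z.2) z.1 z.1.2⟩, by fun_prop⟩ ⟨a, haW⟩ ?_ ?_ ?_
    · intro t; apply Subtype.ext; simp [γ']
    · intro t; apply Subtype.ext; simp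
    · intro t; apply Subtype.ext; simp [hc0', hc1']

/-- Linearly independent `q`-tuples in `ℂ^n` form a simply connected space when `q < n`. -/
lemma simplyConnected_linInd {n q : ℕ} (hq0 : 0 < q) (hq : q < n) :
    SimplyConnectedSpace {y : Fin q → Fin n → ℂ | LinearIndependent ℂ y} := by
  refine simplyConnected_of_genericCone isOpen_setOfPred_linearIndependent ?_ ?_
  · have := (Pi.basisFun ℂ (Fin n)).linearIndependent
    exact ⟨_, this.comp (Fin.castLE hq.le) (Fin.castLE_injective _)⟩
  · intro c hc
    -- bad apexes
    let Ψ : ∀ j : Fin q, (({i : Fin q // i ≠ j} → Fin n → ℂ) × ({i : Fin q // i ≠ j} → ℂ)) × ℝ × ℝ →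
        (Fin q → Fin n → ℂ) := fun j d k =>
      (if h : k ≠ j then d.1.1 ⟨k, h⟩ else ∑ i, d.1.2 i • d.1.1 i) - d.2.1 • c d.2.2 k
    have hΨ : ∀ j, ContDiff ℝ 1 (Ψ j) := by
      intro j
      rw [contDiff_pi]
      intro k
      have hck : ContDiff ℝ 1 fun t => c t k := by
        rw [contDiff_pi] at hc; exact hc k
      unfold Ψ
      by_cases h : k ≠ j
      · simp only [h, dite_true, not_false_eq_true, ne_eq]
        fun_prop
      · simp only [h, dite_false]
        fun_prop
    have hdim : dimH (⋃ j, range (Ψ j)) < Module.finrank ℝ (Fin q → Fin n → ℂ) := by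
      rw [dimH_iUnion]
      have hle : ∀ j, dimH (range (Ψ j)) ≤ ((2 * (q - 1) * (n + 1) + 2 : ℕ) : ENNReal) := by
        intro j
        refine (hΨ j).dimH_range_le.trans (le_of_eq ?_)
        congr 1
        have h1 : Module.finrank ℝ (Fin n → ℂ) = n * 2 := by
          simp [Module.finrank_pi_fintype]
        have h2 : Module.finrank ℝ ({i : Fin q // i ≠ j} → Fin n → ℂ) = (q - 1) * (n * 2) := by
          simp [Module.finrank_pi_fintype, h1]
        have h3 : Module.finrank ℝ ({i : Fin q // i ≠ j} → ℂ) = (q - 1) * 2 := by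
          simp [Module.finrank_pi_fintype]
        simp only [Module.finrank_prod, h2, h3, Module.finrank_self]
        ring
      refine lt_of_le_of_lt (iSup_le hle) ?_
      have h4 : Module.finrank ℝ (Fin q → Fin n → ℂ) = q * (n * 2) := by
        simp [Module.finrank_pi_fintype]
      rw [h4, Nat.cast_lt]
      obtain ⟨r, rfl⟩ : ∃ r, q = r + 1 := ⟨q - 1, by omega⟩
      simp only [Nat.add_sub_cancel]
      nlinarith
    obtain ⟨a, ha⟩ := (dense_compl_of_dimH_lt_finrank hdim).nonempty
    refine ⟨a, fun t ht s hs => ?_⟩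
    rcases eq_or_lt_of_le hs.1 with h0 | hpos
    · subst h0; simpa using ht
    by_contra hbad
    rw [mem_ofPred_eq, Fintype.not_linearIndependent_iff] at hbad
    obtain ⟨g, hg, j, hj⟩ := hbad
    apply ha
    rw [mem_iUnion]
    refine ⟨j, ((fun i => a i + ((1 - s)/s) • c t i, fun i => - (g i / g j)), (1-s)/s, t), ?_⟩
    have hs0 : s ≠ 0 := hpos.ne'
    funext k
    by_cases h : k ≠ j
    · simp [Ψ, h]
    · push Not at h
      subst h
      simp only [Ψ, ne_eq, not_true_eq_false, dite_false]
      have hsC : (s : ℂ) ≠ 0 := by exact_mod_cast hs0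
      funext m
      have hm := congrFun hg m
      rw [Finset.sum_apply, ← Finset.add_sum_erase _ _ (Finset.mem_univ k)] at hm
      have hsub : ∀ F : Fin q → ℂ, ∑ i : {i : Fin q // ¬ i = k}, F i = ∑ i ∈ Finset.univ.erase k, F i := by
        intro F
        exact (Finset.sum_subtype (Finset.univ.erase k) (by simp) F).symm
      have e1 := hsub (fun i => -(g i / g k) * (a i m + ((1 - s)/s) * c t i m))
      simp only [Pi.sub_apply, Finset.sum_apply, Pi.smul_apply, Pi.add_apply, smul_eq_mul,
        Complex.real_smul, Complex.ofReal_div, Complex.ofReal_sub, Complex.ofReal_one, Pi.zero_apply] at hm ⊢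
      rw [e1]
      have e2 : ∑ i ∈ Finset.univ.erase k, -(g i / g k) * (a i m + ((1 - s)/s) * c t i m)
          = - (1 / (s * g k)) * ∑ i ∈ Finset.univ.erase k, g i * ((1 - s) * c t i m + s * a i m) := by
        rw [Finset.mul_sum]
        refine Finset.sum_congr rfl fun i _ => ?_
        field_simp
        ring
      rw [e2, eq_neg_of_add_eq_zero_right hm]
      field_simp
      ring

end LieBall

namespace LieBall
open Set Topology unitInterval

section sqrtpart
variable {m n q : ℕ}

/-- Entrywise complex conjugate. -/
def cj {m n : Type*} (A : Matrix m n ℂ) : Matrix m n ℂ := A.map (starRingEnd ℂ)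

lemma cj_mul {l m n : Type*} [Fintype m] (A : Matrix l m ℂ) (B : Matrix m n ℂ) :
    cj (A * B) = cj A * cj B := Matrix.map_mul
lemma cj_add {m n : Type*} (A B : Matrix m n ℂ) : cj (A + B) = cj A + cj B := by
  ext; simp [cj]
lemma cj_sub {m n : Type*} (A B : Matrix m n ℂ) : cj (A - B) = cj A - cj B := by
  ext; simp [cj]
lemma cj_cj {m n : Type*} (A : Matrix m n ℂ) : cj (cj A) = A := by
  ext; simp [cj]
lemma cj_one {m : Type*} [DecidableEq m] : cj (1 : Matrix m m ℂ) = 1 := by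
  ext i j; by_cases h : i = j <;> simp [cj, Matrix.one_apply, h]
lemma cj_transpose {m n : Type*} (A : Matrix m n ℂ) : (cj A)ᵀ = Aᴴ := by
  ext; simp [cj]
lemma cj_eq {m n : Type*} (A : Matrix m n ℂ) : cj A = (Aᴴ)ᵀ := by
  ext; simp [cj]
lemma cj_conjTranspose {m n : Type*} (A : Matrix m n ℂ) : (cj A)ᴴ = Aᵀ := by
  ext; simp [cj]
lemma transpose_cj {m n : Type*} (A : Matrix m n ℂ) : cj Aᵀ = Aᴴ := by
  ext; simp [cj]
lemma conjTranspose_cj {m n : Type*} (A : Matrix m n ℂ) : cj Aᴴ = Aᵀ := by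
  ext; simp [cj]
lemma conjTranspose_of_real {m n : Type*} {A : Matrix m n ℂ} (h : cj A = A) : Aᴴ = Aᵀ := by
  rw [← cj_transpose, h]
lemma continuous_cj {m n : Type*} : Continuous (cj : Matrix m n ℂ → Matrix m n ℂ) := by
  unfold cj
  exact Continuous.matrix_map continuous_id Complex.continuous_conj
lemma cj_inv {m : Type*} [Fintype m] [DecidableEq m] (A : Matrix m m ℂ) : cj A⁻¹ = (cj A)⁻¹ := by
  rw [cj_eq, cj_eq, Matrix.conjTranspose_nonsing_inv, Matrix.transpose_nonsing_inv]

open scoped MatrixOrder Matrix.Norms.L2Operator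

/-- Positive square root of a matrix. -/
noncomputable def msqrt (A : Matrix (Fin q) (Fin q) ℂ) : Matrix (Fin q) (Fin q) ℂ := CFC.sqrt A

lemma msqrt_posSemidef (A : Matrix (Fin q) (Fin q) ℂ) : (msqrt A).PosSemidef :=
  nonneg_iff_posSemidef.1 (CFC.sqrt_nonneg A)

lemma msqrt_mul_self {A : Matrix (Fin q) (Fin q) ℂ} (hA : A.PosSemidef) :
    msqrt A * msqrt A = A := CFC.sqrt_mul_sqrt_self A (nonneg_iff_posSemidef.2 hA)

lemma msqrt_unique {A B : Matrix (Fin q) (Fin q) ℂ} (hB : B.PosSemidef) (h : B * B = A) :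
    msqrt A = B := CFC.sqrt_unique h (nonneg_iff_posSemidef.2 hB)

lemma continuousOn_msqrt : ContinuousOn (msqrt : Matrix (Fin q) (Fin q) ℂ → _)
    {A | A.PosSemidef} := by
  have h : ContinuousOn (fun A : Matrix (Fin q) (Fin q) ℂ => cfc NNReal.sqrt A)
      {A | A.PosSemidef} := by
    refine ContinuousOn.cfc_nnreal_of_mem_nhdsSet (s := univ) NNReal.sqrt (a := id) Filter.univ_mem
      continuousOn_id ?_ ?_
    · intro A hA; exact nonneg_iff_posSemidef.2 hA
    · exact NNReal.continuous_sqrt.continuousOn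
  refine h.congr fun A hA => ?_
  exact CFC.sqrt_eq_cfc

end sqrtpart

variable {n q : ℕ}

/-- Polar retraction. -/
noncomputable def rho (y : Matrix (Fin n) (Fin q) ℂ) : Matrix (Fin n) (Fin q) ℂ :=
  y * (msqrt (yᴴ * y))⁻¹

lemma msqrt_det_ne {A : Matrix (Fin q) (Fin q) ℂ} (hA : A.PosSemidef) (h : A.det ≠ 0) :
    (msqrt A).det ≠ 0 := by
  intro h0
  apply h
  rw [← msqrt_mul_self hA, Matrix.det_mul, h0, zero_mul]

lemma msqrt_inv_herm (A : Matrix (Fin q) (Fin q) ℂ) : ((msqrt A)⁻¹)ᴴ = (msqrt A)⁻¹ := by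
  rw [Matrix.conjTranspose_nonsing_inv, (msqrt_posSemidef A).1]

lemma rho_mem {y : Matrix (Fin n) (Fin q) ℂ} (h : (yᴴ * y).det ≠ 0) :
    (rho y)ᴴ * rho y = 1 := by
  have hp := Matrix.posSemidef_conjTranspose_mul_self y
  have hd := (msqrt_det_ne hp h).isUnit
  unfold rho
  rw [conjTranspose_mul, msqrt_inv_herm]
  set S := msqrt (yᴴ * y) with hS
  have : S⁻¹ * yᴴ * (y * S⁻¹) = S⁻¹ * (yᴴ * y) * S⁻¹ := by simp only [Matrix.mul_assoc]
  rw [this, ← msqrt_mul_self hp, ← hS, ← Matrix.mul_assoc, Matrix.nonsing_inv_mul _ hd,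
    Matrix.one_mul, Matrix.mul_nonsing_inv _ hd]

lemma rho_smul_frame {v : Matrix (Fin n) (Fin q) ℂ} (h : vᴴ * v = 1) {c : ℂ} (hc : 0 < c) :
    rho (c • v) = v := by
  have hcs : star c = c := IsSelfAdjoint.of_nonneg hc.le
  have h1 : (c • v)ᴴ * (c • v) = (c * c) • 1 := by
    rw [conjTranspose_smul, Matrix.smul_mul, Matrix.mul_smul, h, smul_smul, hcs]
  have h2 : msqrt ((c * c) • (1 : Matrix (Fin q) (Fin q) ℂ)) = c • 1 := by
    apply msqrt_unique
    · exact Matrix.PosSemidef.smul Matrix.PosSemidef.one hc.le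
    · rw [Matrix.smul_mul, Matrix.mul_smul, smul_smul, Matrix.mul_one]
  have hc' : c ≠ 0 := hc.ne'
  unfold rho
  rw [h1, h2]
  have h3 : (c • (1 : Matrix (Fin q) (Fin q) ℂ))⁻¹ = c⁻¹ • 1 := by
    apply Matrix.inv_eq_right_inv
    rw [Matrix.smul_mul, Matrix.mul_smul, smul_smul, Matrix.mul_one, mul_inv_cancel₀ hc', one_smul]
  rw [h3, Matrix.smul_mul, Matrix.mul_smul, smul_smul, Matrix.mul_one, mul_inv_cancel₀ hc', one_smul]

lemma rho_frame {v : Matrix (Fin n) (Fin q) ℂ} (h : vᴴ * v = 1) : rho v = v := by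
  simpa using rho_smul_frame h zero_lt_one

lemma cj_posSemidef {A : Matrix (Fin q) (Fin q) ℂ} (h : A.PosSemidef) : (cj A).PosSemidef := by
  have : cj A = Aᵀ := by rw [cj_eq, h.1]
  rw [this]; exact h.transpose

lemma rho_mul_real {u : Matrix (Fin n) (Fin q) ℂ} (hu : uᴴ * u = 1) {C : Matrix (Fin q) (Fin q) ℂ}
    (hC : cj C = C) (hd : C.det ≠ 0) :
    ∃ O : Matrix (Fin q) (Fin q) ℂ, cj O = O ∧ Oᴴ * O = 1 ∧ rho (u * C) = u * O := by
  have hy : (u * C)ᴴ * (u * C) = Cᴴ * C := by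
    rw [conjTranspose_mul, Matrix.mul_assoc, ← Matrix.mul_assoc uᴴ, hu, Matrix.one_mul]
  have hdd : (Cᴴ * C).det ≠ 0 := by
    rw [Matrix.det_mul, Matrix.det_conjTranspose]
    exact mul_ne_zero (star_ne_zero.2 hd) hd
  refine ⟨rho C, ?_, rho_mem hdd, ?_⟩
  · unfold rho
    rw [cj_mul, cj_inv, hC]
    congr 2
    symm
    apply msqrt_unique (cj_posSemidef (msqrt_posSemidef _))
    rw [← cj_mul, msqrt_mul_self (Matrix.posSemidef_conjTranspose_mul_self C), cj_mul, hC,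
      conjTranspose_cj, conjTranspose_of_real hC]
  · unfold rho
    rw [hy, Matrix.mul_assoc]

lemma continuousOn_rho : ContinuousOn (rho : Matrix (Fin n) (Fin q) ℂ → _)
    {y | (yᴴ * y).det ≠ 0} := by
  have h1 : ContinuousOn (fun y : Matrix (Fin n) (Fin q) ℂ => msqrt (yᴴ * y)) {y | (yᴴ * y).det ≠ 0} := by
    refine continuousOn_msqrt.comp (t := {A | A.PosSemidef}) ?_ ?_
    · exact (by fun_prop : Continuous fun y : Matrix (Fin n) (Fin q) ℂ => yᴴ * y).continuousOn
    · intro y _; exact Matrix.posSemidef_conjTranspose_mul_self y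
  intro y hy
  have hd := msqrt_det_ne (Matrix.posSemidef_conjTranspose_mul_self y) hy
  have h2 : ContinuousAt (fun A : Matrix (Fin q) (Fin q) ℂ => A⁻¹) (msqrt (yᴴ * y)) := by
    apply continuousAt_matrix_inv
    have : Ring.inverse = fun x : ℂ => x⁻¹ := by ext; simp
    rw [this]
    exact continuousAt_inv₀ hd
  have h3 : ContinuousWithinAt (fun y : Matrix (Fin n) (Fin q) ℂ => (msqrt (yᴴ * y))⁻¹) _ y := ContinuousAt.comp_continuousWithinAt (f := fun y : Matrix (Fin n) (Fin q) ℂ => msqrt (yᴴ * y)) h2 (h1 y hy)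
  unfold rho
  have := (continuousWithinAt_id (x := y)).prodMk h3
  exact (Continuous.continuousAt (f := fun z : Matrix (Fin n) (Fin q) ℂ × Matrix (Fin q) (Fin q) ℂ => z.1 * z.2) (by fun_prop)).comp_continuousWithinAt this

end LieBall

namespace LieBall
open Set Topology unitInterval

section orth
variable {q : ℕ}

/-- Orthogonal real matrices. -/
def OR (q : ℕ) : Set (Matrix (Fin q) (Fin q) ℝ) := {A | Aᵀ * A = 1}

/-- Householder matrices. -/
noncomputable def hh (u : Fin q → ℝ) : Matrix (Fin q) (Fin q) ℝ :=
  1 - (2 / (u ⬝ᵥ u)) • vecMulVec u u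

lemma dot_ne {u : Fin q → ℝ} (hu : u ≠ 0) : u ⬝ᵥ u ≠ 0 := by
  simpa using hu

lemma hh_mem (u : Fin q → ℝ) : hh u ∈ OR q := by
  unfold OR hh
  by_cases hu : u = 0
  · subst hu; simp
  have h := dot_ne hu
  have h2 : vecMulVec u u * vecMulVec u u = (u ⬝ᵥ u) • vecMulVec u u := by
    rw [Matrix.vecMulVec_mul_vecMulVec]
    ext i j; simp [vecMulVec_apply]; ring
  rw [mem_ofPred_eq, Matrix.transpose_sub, Matrix.transpose_smul, Matrix.transpose_vecMulVec]
  simp only [Matrix.sub_mul, Matrix.mul_sub, Matrix.smul_mul, Matrix.mul_smul, h2, Matrix.mul_one,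
    Matrix.one_mul, transpose_one, smul_sub, smul_smul]
  have : 2 / (u ⬝ᵥ u) * (2 / (u ⬝ᵥ u) * (u ⬝ᵥ u)) = 2 / (u ⬝ᵥ u) + 2 / (u ⬝ᵥ u) := by
    field_simp; ring
  rw [this, add_smul]
  abel

lemma hh_joined {u w : Fin q → ℝ} (hu : u ≠ 0) (hw : w ≠ 0) : JoinedIn (OR q) (hh u) (hh w) := by
  by_cases hq : q = 1
  · subst hq
    have : ∀ u : Fin 1 → ℝ, u ≠ 0 → hh u = -1 := by
      intro u hu
      have h := dot_ne hu
      have h0 : u 0 ≠ 0 := by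
        simpa [dotProduct] using h
      ext i j
      fin_cases i; fin_cases j
      simp [hh, vecMulVec_apply, dotProduct]
      field_simp
      norm_num
    rw [this u hu, this w hw, ← this w hw]
    exact JoinedIn.refl (hh_mem w)
  · have hq2 : 1 < q := by
      by_contra h
      have : q = 0 := by omega
      subst this
      exact hu (Subsingleton.elim _ _)
    have hpc : IsPathConnected ({0}ᶜ : Set (Fin q → ℝ)) := by
      apply isPathConnected_compl_singleton_of_one_lt_rank
      rw [rank_fin_fun]
      exact_mod_cast hq2
    obtain ⟨p, hp⟩ := hpc.joinedIn u hu w hw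
    have hp' : ∀ t, p t ⬝ᵥ p t ≠ 0 := fun t => dot_ne (hp t)
    refine ⟨⟨⟨fun t => hh (p t), ?_⟩, by simp, by simp⟩, fun t => hh_mem _⟩
    unfold hh
    have h1 : Continuous fun t => p t ⬝ᵥ p t := by
      unfold dotProduct; fun_prop
    have h2 : Continuous fun t => (2:ℝ) / (p t ⬝ᵥ p t) := continuous_const.div h1 hp'
    have h3 : Continuous fun t => vecMulVec (p t) (p t) := by
      apply continuous_matrix
      intro i j
      simp only [vecMulVec_apply]; fun_prop
    exact continuous_const.sub (h2.smul h3)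

lemma OR_mul {A B : Matrix (Fin q) (Fin q) ℝ} (hA : A ∈ OR q) (hB : B ∈ OR q) : A * B ∈ OR q := by
  unfold OR at *
  rw [mem_ofPred_eq] at *
  rw [transpose_mul, Matrix.mul_assoc, ← Matrix.mul_assoc _ A, hA, Matrix.one_mul, hB]

lemma JoinedIn_mul {A B A' B' : Matrix (Fin q) (Fin q) ℝ} (hA : JoinedIn (OR q) A A')
    (hB : JoinedIn (OR q) B B') : JoinedIn (OR q) (A * B) (A' * B') := by
  obtain ⟨p, hp⟩ := hA
  obtain ⟨r, hr⟩ := hB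
  exact ⟨⟨⟨fun t => p t * r t, by fun_prop⟩, by simp, by simp⟩, fun t => OR_mul (hp t) (hr t)⟩

lemma OR_eq_prod {A : Matrix (Fin q) (Fin q) ℝ} (hA : A ∈ OR q) :
    ∃ l : List (Fin q → ℝ), A = (l.map hh).prod := by
  let b := EuclideanSpace.basisFun (Fin q) ℝ
  let f : EuclideanSpace ℝ (Fin q) →ₗ[ℝ] EuclideanSpace ℝ (Fin q) :=
    Matrix.toLin b.toBasis b.toBasis A
  have hfb : ∀ i j, (f (b i)) j = A j i := by
    intro i j
    have := Matrix.toLin_self b.toBasis b.toBasis A i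
    rw [b.coe_toBasis] at this
    simp only [f]
    rw [this]
    rw [WithLp.ofLp_sum, Finset.sum_apply, Finset.sum_eq_single j]
    · simp [b]
    · intro k _ hk
      simp [b, hk.symm]
    · simp
  have hon : Orthonormal ℝ (f ∘ b.toBasis) := by
    rw [orthonormal_iff_ite]
    intro i j
    have := congrFun (congrFun hA i) j
    rw [Matrix.one_apply] at this
    rw [← this]
    simp only [Function.comp, b.coe_toBasis]
    rw [PiLp.inner_apply, Matrix.mul_apply]
    refine Finset.sum_congr rfl fun k _ => ?_
    rw [hfb, hfb]
    simp [mul_comm]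
  let φ := (f.isometryOfOrthonormal (by simpa using b.orthonormal) hon).toLinearIsometryEquiv rfl
  obtain ⟨l, -, hl⟩ := φ.reflections_generate_dim
  refine ⟨l.map (fun v => v.ofLp), ?_⟩
  let T : (EuclideanSpace ℝ (Fin q) ≃ₗᵢ[ℝ] EuclideanSpace ℝ (Fin q)) → Matrix (Fin q) (Fin q) ℝ :=
    fun ψ => LinearMap.toMatrix b.toBasis b.toBasis (ψ.toLinearEquiv : EuclideanSpace ℝ (Fin q) →ₗ[ℝ] EuclideanSpace ℝ (Fin q))
  have hTA : T φ = A := by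
    have : ((φ.toLinearEquiv : EuclideanSpace ℝ (Fin q) →ₗ[ℝ] EuclideanSpace ℝ (Fin q))) = f := by
      ext1 x; rfl
    simp only [T, this]
    exact LinearMap.toMatrix_toLin _ _ _
  have hT1 : T 1 = 1 := LinearMap.toMatrix_one _
  have hTm : ∀ ψ χ, T (ψ * χ) = T ψ * T χ := fun ψ χ => LinearMap.toMatrix_mul _ _ _
  have hTr : ∀ v : EuclideanSpace ℝ (Fin q), T ((ℝ ∙ v)ᗮ.reflection) = hh v.ofLp := by
    intro v
    ext i j
    simp only [T, LinearMap.toMatrix_apply, hh]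
    have e1 : (((ℝ ∙ v)ᗮ.reflection.toLinearEquiv : EuclideanSpace ℝ (Fin q) →ₗ[ℝ] EuclideanSpace ℝ (Fin q)) (b.toBasis j)) = (ℝ ∙ v)ᗮ.reflection (b j) := by
      rw [b.coe_toBasis]; rfl
    rw [e1, Submodule.reflection_orthogonal_apply, Submodule.reflection_singleton_apply]
    have e2 : ((‖v‖ : ℝ)) ^ 2 = v.ofLp ⬝ᵥ v.ofLp := by
      rw [EuclideanSpace.real_norm_sq_eq]
      simp [dotProduct, sq]
    have e3 : inner ℝ v (b j) = v j := by
      rw [PiLp.inner_apply]; simp [b]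
    have e4 : (b j).ofLp i = (1 : Matrix (Fin q) (Fin q) ℝ) i j := by
      simp [b, Matrix.one_apply, Pi.single_apply]
    rw [e3]
    simp only [RCLike.ofReal_real_eq_id, id, e2]
    rw [b.coe_toBasis_repr_apply, EuclideanSpace.basisFun_repr]
    simp [e4, vecMulVec_apply]
    ring
  rw [← hTA, hl]
  clear hl
  induction l with
  | nil => simpa using hT1
  | cons v l ih => simp only [List.map_cons, List.prod_cons, hTm, hTr, ih]

lemma hh_det {u : Fin q → ℝ} (hu : u ≠ 0) : (hh u).det = -1 := by
  unfold hh
  have h := dot_ne hu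
  have e : (1 - (2 / (u ⬝ᵥ u)) • vecMulVec u u : Matrix (Fin q) (Fin q) ℝ)
      = 1 + replicateCol Unit ((-(2 / (u ⬝ᵥ u))) • u) * replicateRow Unit u := by
    ext i j
    simp [vecMulVec_apply, Matrix.mul_apply]
    ring
  rw [e, det_one_add_replicateCol_mul_replicateRow, dotProduct_smul, smul_eq_mul]
  field_simp
  norm_num

lemma OR_joined {u : Fin q → ℝ} (hu : u ≠ 0) {A : Matrix (Fin q) (Fin q) ℝ} (hA : A ∈ OR q) :
    JoinedIn (OR q) A 1 ∨ JoinedIn (OR q) A (hh u) := by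
  obtain ⟨l, rfl⟩ := OR_eq_prod hA
  clear hA
  have h1 : (1 : Matrix (Fin q) (Fin q) ℝ) ∈ OR q := by simp [OR]
  induction l with
  | nil => left; simpa using JoinedIn.refl h1
  | cons v l ih =>
    simp only [List.map_cons, List.prod_cons]
    by_cases hv : v = 0
    · have : hh v = 1 := by simp [hh, hv]
      rw [this, one_mul]; exact ih
    · have hj := hh_joined hv hu
      rcases ih with ih | ih
      · right; simpa using JoinedIn_mul hj ih
      · left
        have := JoinedIn_mul hj ih
        have h2 : hh u * hh u = 1 := by
          have := hh_mem u
          unfold OR at this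
          rw [mem_ofPred_eq] at this
          have ht : (hh u)ᵀ = hh u := by simp [hh, Matrix.transpose_vecMulVec]
          rwa [ht] at this
        rwa [h2] at this

/-- Real orthogonal matrices inside complex matrices. -/
def OC (q : ℕ) : Set (Matrix (Fin q) (Fin q) ℂ) := {A | cj A = A ∧ Aᴴ * A = 1}

lemma OC_det {A : Matrix (Fin q) (Fin q) ℂ} (hA : A ∈ OC q) : A.det = 1 ∨ A.det = -1 := by
  have h := congrArg Matrix.det hA.2
  rw [conjTranspose_of_real hA.1, Matrix.det_mul, det_transpose, det_one] at h
  exact mul_self_eq_one_iff.1 h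

lemma OC_of_OR {A : Matrix (Fin q) (Fin q) ℝ} (hA : A ∈ OR q) : A.map Complex.ofRealHom ∈ OC q := by
  have h1 : cj (A.map Complex.ofRealHom) = A.map Complex.ofRealHom := by
    ext i j; simp [cj]
  refine ⟨h1, ?_⟩
  rw [conjTranspose_of_real h1, ← transpose_map, ← Matrix.map_mul]
  rw [show Aᵀ * A = 1 from hA]
  exact Matrix.map_one _ (by simp) (by simp)

lemma OC_exists_OR {A : Matrix (Fin q) (Fin q) ℂ} (hA : A ∈ OC q) :
    ∃ B ∈ OR q, A = B.map Complex.ofRealHom := by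
  have h : A = (A.map Complex.re).map Complex.ofRealHom := by
    ext i j
    have := congrFun (congrFun hA.1 i) j
    simp only [cj, map_apply] at this
    exact (Complex.conj_eq_iff_re.1 this).symm
  refine ⟨_, ?_, h⟩
  have h2 := hA.2
  rw [conjTranspose_of_real hA.1, h, ← transpose_map, ← Matrix.map_mul] at h2
  have h3 : ((A.map Complex.re)ᵀ * A.map Complex.re).map Complex.ofRealHom = (1 : Matrix (Fin q) (Fin q) ℝ).map Complex.ofRealHom := by
    rw [h2]; exact (Matrix.map_one _ (by simp) (by simp)).symm
  exact Matrix.map_injective Complex.ofReal_injective h3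

lemma OC_joined_of_det {A : Matrix (Fin q) (Fin q) ℂ} (hA : A ∈ OC q) (hd : A.det = 1) :
    JoinedIn (OC q) A 1 := by
  rcases Nat.eq_zero_or_pos q with h0 | hq
  · subst h0
    have : A = 1 := Subsingleton.elim _ _
    rw [this]
    exact JoinedIn.refl ⟨cj_one, by rw [conjTranspose_one, Matrix.one_mul]⟩
  obtain ⟨B, hB, rfl⟩ := OC_exists_OR hA
  have key : ∀ C, JoinedIn (OR q) B C → JoinedIn (OC q) (B.map Complex.ofRealHom) (C.map Complex.ofRealHom) := by
    rintro C ⟨p, hp⟩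
    exact ⟨⟨⟨fun t => (p t).map Complex.ofRealHom, Continuous.matrix_map (by fun_prop) Complex.continuous_ofReal⟩, by simp, by simp⟩,
      fun t => OC_of_OR (hp t)⟩
  let u : Fin q → ℝ := fun _ => 1
  have hu : u ≠ 0 := fun h => one_ne_zero (congrFun h ⟨0, hq⟩)
  rcases OR_joined hu hB with h | h
  · have := key _ h
    rwa [Matrix.map_one _ (by simp) (by simp)] at this
  · exfalso
    have hBd : B.det = 1 := by
      have : Complex.ofRealHom B.det = 1 := by rw [RingHom.map_det]; exact hd
      simpa using this
    obtain ⟨p, hp⟩ := h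
    -- the determinant is constant along `p`
    have hc : Continuous fun t => (p t).det := by fun_prop
    have hv : ∀ t, (p t).det = 1 ∨ (p t).det = -1 := by
      intro t
      have := congrArg Matrix.det (hp t)
      rw [det_mul, det_transpose, det_one] at this
      exact mul_self_eq_one_iff.1 this
    have hz : (0:ℝ) ∈ range (fun t => (p t).det) := by
      have := isPreconnected_range hc
      refine this.Icc_subset (a := -1) (b := 1) ⟨1, ?_⟩ ⟨0, ?_⟩ (by norm_num)
      · simp [hh_det hu]
      · simp [hBd]
    obtain ⟨t, ht⟩ := hz
    rcases hv t with h | h <;> simp only [h] at ht <;> norm_num at ht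

lemma OC_exists_neg (hq : 0 < q) : ∃ D ∈ OC q, D.det = -1 := by
  let u : Fin q → ℝ := fun _ => 1
  have hu : u ≠ 0 := fun h => one_ne_zero (congrFun h ⟨0, hq⟩)
  refine ⟨_, OC_of_OR (hh_mem u), ?_⟩
  have := RingHom.map_det Complex.ofRealHom (hh u)
  rw [hh_det hu] at this
  simpa using this.symm

end orth

end LieBall

namespace LieBall
open Set Topology unitInterval

/-- Unitary frames. -/
def Fr (n q : ℕ) : Set (Matrix (Fin n) (Fin q) ℂ) := {v | vᴴ * v = 1}

lemma simplyConnected_retract {X Y : Type*} [TopologicalSpace X] [TopologicalSpace Y]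
    [SimplyConnectedSpace Y] (i : C(X, Y)) (r : C(Y, X)) (h : ∀ x, r (i x) = x) :
    SimplyConnectedSpace X := by
  rw [simply_connected_iff_paths_homotopic']
  refine ⟨?_, ?_⟩
  · have : Function.Surjective r := fun x => ⟨i x, h x⟩
    exact this.pathConnectedSpace r.continuous
  · intro x y p₁ p₂
    have h1 : (p₁.map i.continuous).Homotopic (p₂.map i.continuous) :=
      SimplyConnectedSpace.paths_homotopic _ _
    have h2 := h1.map r
    obtain ⟨F⟩ := h2
    have hr : ∀ (p : Path x y), ((p.map i.continuous).map r.continuous) = p.cast (h x) (h y) := by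
      intro p; ext t; simp [h]
    have h3 : (p₁.cast (h x) (h y)).Homotopic (p₂.cast (h x) (h y)) := by
      rw [← hr, ← hr]; exact ⟨F⟩
    obtain ⟨G⟩ := h3
    exact ⟨G.pathCast (h x).symm (h y).symm⟩

lemma linInd_det {n q : ℕ} {y : Matrix (Fin n) (Fin q) ℂ} (h : LinearIndependent ℂ yᵀ) :
    (yᴴ * y).det ≠ 0 := by
  have h1 : Function.Injective y.mulVec := Matrix.mulVec_injective_iff.2 h
  intro h0
  obtain ⟨w, hw, hw0⟩ := Matrix.exists_mulVec_eq_zero_iff.2 h0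
  rw [Matrix.conjTranspose_mul_self_mulVec_eq_zero] at hw0
  exact hw (h1 (by rw [hw0, Matrix.mulVec_zero]))

lemma linInd_frame {n q : ℕ} {v : Matrix (Fin n) (Fin q) ℂ} (h : v ∈ Fr n q) :
    LinearIndependent ℂ vᵀ := by
  apply Matrix.mulVec_injective_iff.1
  intro a b hab
  have := congrArg (fun w => vᴴ *ᵥ w) hab
  simpa [Matrix.mulVec_mulVec, show vᴴ * v = 1 from h] using this

theorem simplyConnected_Fr {n q : ℕ} (hq0 : 0 < q) (hq : q < n) : SimplyConnectedSpace (Fr n q) := by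
  haveI := simplyConnected_linInd hq0 hq
  let i : C(Fr n q, {y : Fin q → Fin n → ℂ | LinearIndependent ℂ y}) :=
    ⟨fun v => ⟨v.1ᵀ, linInd_frame v.2⟩, by
      apply Continuous.subtype_mk
      exact continuous_subtype_val.matrix_transpose⟩
  let r : C({y : Fin q → Fin n → ℂ | LinearIndependent ℂ y}, Fr n q) :=
    ⟨fun y => ⟨rho (Matrix.transpose y.1), rho_mem (linInd_det y.2)⟩, by
      apply Continuous.subtype_mk
      refine continuousOn_rho.comp_continuous ?_ fun y => linInd_det y.2
      exact Continuous.matrix_transpose (continuous_subtype_val)⟩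
  refine simplyConnected_retract i r fun v => Subtype.ext ?_
  exact rho_frame v.2

end LieBall

namespace LieBall
open Set Topology unitInterval

section lifting
variable {n q : ℕ}

/-- Transport of frames. -/
def tr (w : Matrix (Fin n) (Fin n) ℂ) (v : Matrix (Fin n) (Fin q) ℂ) : Matrix (Fin n) (Fin q) ℂ :=
  w * cj w * v + w * cj v

lemma frame_transpose {u : Matrix (Fin n) (Fin q) ℂ} (hu : u ∈ Fr n q) : uᵀ * cj u = 1 := by
  have h := congrArg cj (show uᴴ * u = 1 from hu)
  rwa [cj_mul, conjTranspose_cj, cj_one] at h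

lemma sq_cj {u : Matrix (Fin n) (Fin q) ℂ} (hu : u ∈ Fr n q) :
    u * uᵀ * cj (u * uᵀ) = u * uᴴ := by
  rw [cj_mul, transpose_cj, ← Matrix.mul_assoc, Matrix.mul_assoc u, frame_transpose hu,
    Matrix.mul_one]

lemma tr_eq {u : Matrix (Fin n) (Fin q) ℂ} (hu : u ∈ Fr n q) (v : Matrix (Fin n) (Fin q) ℂ) :
    tr (u * uᵀ) v = u * (uᴴ * v + cj (uᴴ * v)) := by
  unfold tr
  rw [sq_cj hu, Matrix.mul_add, cj_mul, conjTranspose_cj, Matrix.mul_assoc, Matrix.mul_assoc]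

lemma tr_lift {u v : Matrix (Fin n) (Fin q) ℂ} (hu : u ∈ Fr n q)
    (hd : ((tr (u * uᵀ) v)ᴴ * tr (u * uᵀ) v).det ≠ 0) :
    rho (tr (u * uᵀ) v) * (rho (tr (u * uᵀ) v))ᵀ = u * uᵀ := by
  rw [tr_eq hu] at *
  set C := uᴴ * v + cj (uᴴ * v) with hC
  have hCr : cj C = C := by rw [hC, cj_add, cj_cj, add_comm]
  have hCd : C.det ≠ 0 := by
    intro h0
    apply hd
    rw [conjTranspose_mul, Matrix.mul_assoc, ← Matrix.mul_assoc uᴴ, show uᴴ * u = 1 from hu,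
      Matrix.one_mul, det_mul, h0, mul_zero]
  obtain ⟨O, hO, hO2, h⟩ := rho_mul_real hu hCr hCd
  rw [h, transpose_mul, Matrix.mul_assoc, ← Matrix.mul_assoc O]
  have : O * Oᵀ = 1 := by
    rw [← conjTranspose_of_real hO]
    exact mul_eq_one_comm.1 hO2
  rw [this, Matrix.one_mul]

lemma tr_self {v : Matrix (Fin n) (Fin q) ℂ} (hv : v ∈ Fr n q) : tr (v * vᵀ) v = (2:ℂ) • v := by
  rw [tr_eq hv, show vᴴ * v = 1 from hv, cj_one, Matrix.mul_add, Matrix.mul_one, two_smul]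

lemma rho_tr_self {v : Matrix (Fin n) (Fin q) ℂ} (hv : v ∈ Fr n q) : rho (tr (v * vᵀ) v) = v := by
  rw [tr_self hv]
  exact rho_smul_frame hv (by norm_num)

lemma tr_self_det {v : Matrix (Fin n) (Fin q) ℂ} (hv : v ∈ Fr n q) :
    ((tr (v * vᵀ) v)ᴴ * tr (v * vᵀ) v).det ≠ 0 := by
  rw [tr_self hv, conjTranspose_smul, Matrix.smul_mul, Matrix.mul_smul, show vᴴ * v = 1 from hv,
    smul_smul, det_smul, det_one, mul_one]
  exact pow_ne_zero _ (by simp)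

lemma continuous_tr {Z : Type*} [TopologicalSpace Z] {f : Z → Matrix (Fin n) (Fin n) ℂ}
    {g : Z → Matrix (Fin n) (Fin q) ℂ} (hf : Continuous f) (hg : Continuous g) :
    Continuous fun z => tr (f z) (g z) := by
  unfold tr
  exact ((hf.matrix_mul (continuous_cj.comp hf)).matrix_mul hg).add
    (hf.matrix_mul (continuous_cj.comp hg))

lemma isClosed_Fr : IsClosed (Fr n q) :=
  isClosed_eq (by fun_prop) continuous_const

lemma isCompact_Fr : IsCompact (Fr n q) := by
  have hc : IsCompact (Set.pi univ fun _ : Fin n => Set.pi univ fun _ : Fin q => Metric.closedBall (0:ℂ) 1) :=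
    isCompact_univ_pi fun _ => isCompact_univ_pi fun _ => isCompact_closedBall 0 1
  refine hc.of_isClosed_subset isClosed_Fr ?_
  intro (v : Matrix (Fin n) (Fin q) ℂ) hv i _ j _
  have h := congrFun (congrFun (show vᴴ * v = 1 from hv) j) j
  rw [Matrix.mul_apply, Matrix.one_apply_eq] at h
  have h2 : ∑ k, ‖v k j‖ ^ 2 = 1 := by
    have : ((∑ k, ‖v k j‖ ^ 2 : ℝ) : ℂ) = 1 := by
      rw [← h]; push_cast
      refine Finset.sum_congr rfl fun k _ => ?_
      rw [conjTranspose_apply, ← Complex.conj_mul']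
      rfl
    exact_mod_cast this
  rw [mem_closedBall_zero_iff]
  have h3 : ‖v i j‖ ^ 2 ≤ 1 := by
    rw [← h2]
    exact Finset.single_le_sum (f := fun k => ‖v k j‖ ^ 2) (fun k _ => sq_nonneg _) (Finset.mem_univ i)
  nlinarith [norm_nonneg (v i j)]

theorem exists_lift {K : Type*} [TopologicalSpace K] [CompactSpace K]
    {F : K × I → Matrix (Fin n) (Fin n) ℂ} (hF : Continuous F)
    (hX : ∀ x, ∃ v ∈ Fr n q, v * vᵀ = F x)
    {g0 : K → Matrix (Fin n) (Fin q) ℂ} (hg0 : Continuous g0) (hg0F : ∀ k, g0 k ∈ Fr n q)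
    (hg0' : ∀ k, g0 k * (g0 k)ᵀ = F (k, 0)) :
    ∃ g : K × I → Matrix (Fin n) (Fin q) ℂ, Continuous g ∧ (∀ x, g x ∈ Fr n q) ∧
      (∀ x, g x * (g x)ᵀ = F x) ∧ ∀ k, g (k, 0) = g0 k := by
  let B : Set ((K × I × I) × Matrix (Fin n) (Fin q) ℂ) :=
    (univ ×ˢ Fr n q) ∩ {x | x.2 * x.2ᵀ = F (x.1.1, x.1.2.1) ∧
      ((tr (F (x.1.1, x.1.2.2)) x.2)ᴴ * tr (F (x.1.1, x.1.2.2)) x.2).det = 0}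
  have hB : IsCompact B := by
    refine (isCompact_univ.prod isCompact_Fr).inter_right ?_
    refine (isClosed_eq (by fun_prop) (by fun_prop)).inter (isClosed_eq ?_ continuous_const)
    have : Continuous fun x : (K × I × I) × Matrix (Fin n) (Fin q) ℂ =>
        tr (F (x.1.1, x.1.2.2)) x.2 := continuous_tr (by fun_prop) (by fun_prop)
    fun_prop
  obtain ⟨δ, hδ, hδB⟩ : ∃ δ : ℝ, 0 < δ ∧ ∀ x ∈ B, δ ≤ |(x.1.2.1 : ℝ) - x.1.2.2| := by
    refine hB.exists_forall_le' (f := fun x : (K × I × I) × Matrix (Fin n) (Fin q) ℂ =>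
      |(x.1.2.1 : ℝ) - x.1.2.2|) (by fun_prop) ?_
    rintro ⟨⟨k, t, t'⟩, v⟩ ⟨⟨-, hv⟩, h1, h2⟩
    simp only at h1 h2 hv ⊢
    rw [abs_pos, sub_ne_zero]
    intro h
    have : t = t' := Subtype.ext h
    subst this
    rw [← h1] at h2
    exact tr_self_det hv h2
  obtain ⟨N, hN⟩ := exists_nat_one_div_lt hδ
  let τ : ℕ → I → I := fun m t => projIcc 0 1 zero_le_one (min (t:ℝ) (m / ((N:ℝ) + 1)))
  have hτ : ∀ m, Continuous (τ m) := fun m => continuous_projIcc.comp (by fun_prop)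
  have hτv : ∀ m t, m ≤ N + 1 → (τ m t : ℝ) = min (t:ℝ) (m / ((N:ℝ) + 1)) := by
    intro m t hm
    have : min (t:ℝ) (m / ((N:ℝ) + 1)) ∈ Icc (0:ℝ) 1 :=
      ⟨le_min t.2.1 (by positivity), (min_le_left _ _).trans t.2.2⟩
    simp only [τ]
    rw [projIcc_of_mem zero_le_one this]
  have hτ0 : ∀ m, m ≤ N + 1 → τ m 0 = 0 := by
    intro m hm
    apply Subtype.ext
    rw [hτv m 0 hm]
    simp only [Icc.coe_zero]
    exact min_eq_left (by positivity)
  have key : ∀ m, m ≤ N + 1 → ∃ g : K × I → Matrix (Fin n) (Fin q) ℂ, Continuous g ∧ (∀ x, g x ∈ Fr n q) ∧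
      (∀ x, g x * (g x)ᵀ = F (x.1, τ m x.2)) ∧ ∀ k, g (k, 0) = g0 k := by
    intro m
    induction m with
    | zero =>
      intro _
      refine ⟨fun x => g0 x.1, by fun_prop, fun x => hg0F _, fun x => ?_, fun k => rfl⟩
      have : τ 0 x.2 = 0 := by
        apply Subtype.ext
        rw [hτv 0 _ (by omega)]
        simpa using x.2.2.1
      rw [this, hg0']
    | succ m ih =>
      intro hm
      obtain ⟨g, hg, hgF, hgl, hgi⟩ := ih (by omega)
      have hd : ∀ x : K × I, ((tr (F (x.1, τ (m+1) x.2)) (g x))ᴴ * tr (F (x.1, τ (m+1) x.2)) (g x)).det ≠ 0 := by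
        intro x h0
        have := hδB ((x.1, τ m x.2, τ (m+1) x.2), g x) ⟨⟨mem_univ _, hgF x⟩, hgl x, h0⟩
        simp only [hτv m _ (show m ≤ N + 1 by omega), hτv (m+1) _ hm] at this
        have h2 : |min (x.2:ℝ) (m / ((N:ℝ) + 1)) - min (x.2:ℝ) ((m+1:ℕ) / ((N:ℝ) + 1))| ≤ 1 / ((N:ℝ)+1) := by
          refine (abs_min_sub_min_le_max _ _ _ _).trans ?_
          rw [sub_self, abs_zero]
          refine max_le (by positivity) ?_
          rw [← sub_div, Nat.cast_succ, sub_add_cancel_left, abs_div, abs_neg, abs_one, abs_of_pos (by positivity)]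
        linarith
      refine ⟨fun x => rho (tr (F (x.1, τ (m+1) x.2)) (g x)), ?_, fun x => rho_mem (hd x), ?_, ?_⟩
      · have := hτ (m+1)
        exact continuousOn_rho.comp_continuous (continuous_tr (by fun_prop) hg) hd
      · intro x
        obtain ⟨u, hu, hux⟩ := hX (x.1, τ (m+1) x.2)
        have h := hd x
        simp only
        rw [← hux] at h ⊢
        exact tr_lift hu h
      · intro k
        have h1 := hgl (k, 0)
        simp only [hτ0 m (by omega), hτ0 (m+1) hm] at h1 ⊢
        rw [← h1, rho_tr_self (hgF _), hgi]
  obtain ⟨g, hg, hgF, hgl, hgi⟩ := key (N+1) le_rfl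
  refine ⟨g, hg, hgF, fun x => ?_, hgi⟩
  rw [hgl]
  have : τ (N+1) x.2 = x.2 := by
    apply Subtype.ext
    rw [hτv _ _ le_rfl, Nat.cast_succ, div_self (by positivity)]
    exact min_eq_left x.2.2.2
  rw [this]

/-- Two frames over the same point differ by a real orthogonal matrix. -/
lemma fiber {u v : Matrix (Fin n) (Fin q) ℂ} (hu : u ∈ Fr n q) (hv : v ∈ Fr n q)
    (h : u * uᵀ = v * vᵀ) : uᴴ * v ∈ OC q ∧ v = u * (uᴴ * v) := by
  have h1 : v = u * (uᴴ * v) := by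
    have h2 := sq_cj hu
    rw [h, sq_cj hv] at h2
    rw [← Matrix.mul_assoc, ← h2, Matrix.mul_assoc, show vᴴ * v = 1 from hv, Matrix.mul_one]
  refine ⟨⟨?_, ?_⟩, h1⟩
  · have h3 : u * cj (uᴴ * v) = v := by
      rw [cj_mul, conjTranspose_cj, ← Matrix.mul_assoc, h, Matrix.mul_assoc, frame_transpose hv,
        Matrix.mul_one]
    have h4 := congrArg (fun w => uᴴ * w) h3
    simp only [← Matrix.mul_assoc, show uᴴ * u = 1 from hu, Matrix.one_mul] at h4
    exact h4
  · have := (show vᴴ * v = 1 from hv)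
    rw [h1, conjTranspose_mul, Matrix.mul_assoc, ← Matrix.mul_assoc uᴴ, show uᴴ * u = 1 from hu,
      Matrix.one_mul] at this
    exact this

lemma OC_mul_transpose {B : Matrix (Fin q) (Fin q) ℂ} (hB : B ∈ OC q) : B * Bᵀ = 1 := by
  rw [← conjTranspose_of_real hB.1]
  exact mul_eq_one_comm.1 hB.2

lemma fiber_mul {u : Matrix (Fin n) (Fin q) ℂ} {B : Matrix (Fin q) (Fin q) ℂ} (hu : u ∈ Fr n q)
    (hB : B ∈ OC q) : u * B ∈ Fr n q ∧ (u * B) * (u * B)ᵀ = u * uᵀ := by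
  constructor
  · show (u * B)ᴴ * (u * B) = 1
    rw [conjTranspose_mul, Matrix.mul_assoc, ← Matrix.mul_assoc uᴴ, show uᴴ * u = 1 from hu,
      Matrix.one_mul, hB.2]
  · rw [transpose_mul, Matrix.mul_assoc, ← Matrix.mul_assoc B, OC_mul_transpose hB, Matrix.one_mul]

end lifting
end LieBall

namespace LieBall
open Set Topology unitInterval

section retr
variable {n q p s : ℕ}

lemma mem_R {z : Matrix (Fin n) (Fin n) ℂ} : z ∈ lieBallBoundary n p ↔
    zᵀ = z ∧ (1 - z * cj z).PosSemidef ∧ (1 - z * cj z).rank = p := Iff.rfl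

lemma rank_add_ker (M : Matrix (Fin n) (Fin n) ℂ) :
    M.rank + Module.finrank ℂ (LinearMap.ker M.mulVecLin) = n := by
  have := LinearMap.finrank_range_add_finrank_ker M.mulVecLin
  rwa [Module.finrank_fin_fun] at this

lemma rank_congr {M N : Matrix (Fin n) (Fin n) ℂ} (h : ∀ w, M *ᵥ w = 0 ↔ N *ᵥ w = 0) :
    M.rank = N.rank := by
  have h1 := rank_add_ker M
  have h2 := rank_add_ker N
  have : LinearMap.ker M.mulVecLin = LinearMap.ker N.mulVecLin := by
    ext w; exact h w
  rw [this] at h1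
  omega

lemma finrank_range_frame {v : Matrix (Fin n) (Fin s) ℂ} (hv : v ∈ Fr n s) :
    Module.finrank ℂ (LinearMap.range v.mulVecLin) = s := by
  have hi : Function.Injective v.mulVecLin := by
    intro a b hab
    have := congrArg (fun w => vᴴ *ᵥ w) hab
    simpa [Matrix.mulVec_mulVec, show vᴴ * v = 1 from hv] using this
  rw [LinearMap.finrank_range_of_inj hi, Module.finrank_fin_fun]

lemma frame_ker {z : Matrix (Fin n) (Fin n) ℂ} {v : Matrix (Fin n) (Fin s) ℂ} (h : z * cj v = v) :
    (1 - z * cj z) * v = 0 := by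
  have h2 := congrArg cj h
  rw [cj_mul, cj_cj] at h2
  rw [Matrix.sub_mul, Matrix.one_mul, Matrix.mul_assoc, h2, h, sub_self]

lemma range_le_ker {z : Matrix (Fin n) (Fin n) ℂ} {v : Matrix (Fin n) (Fin s) ℂ} (h : z * cj v = v) :
    LinearMap.range v.mulVecLin ≤ LinearMap.ker (1 - z * cj z).mulVecLin := by
  rintro _ ⟨a, rfl⟩
  simp only [LinearMap.mem_ker, mulVecLin_apply, mulVec_mulVec, frame_ker h, zero_mulVec]

lemma frame_span (hpq : p + q = n) {z : Matrix (Fin n) (Fin n) ℂ} (hz : z ∈ lieBallBoundary n p)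
    {v : Matrix (Fin n) (Fin q) ℂ} (hv : v ∈ Fr n q) (h : z * cj v = v) {w : Fin n → ℂ}
    (hw : (1 - z * cj z) *ᵥ w = 0) : (v * vᴴ) *ᵥ w = w := by
  have h1 := rank_add_ker (1 - z * cj z)
  rw [(mem_R.1 hz).2.2] at h1
  have h2 := Submodule.eq_of_le_of_finrank_eq (range_le_ker h) (by rw [finrank_range_frame hv]; omega)
  have h3 : w ∈ LinearMap.range v.mulVecLin := by rw [h2]; exact hw
  obtain ⟨a, rfl⟩ := h3
  rw [mulVecLin_apply, mulVec_mulVec, Matrix.mul_assoc, show vᴴ * v = 1 from hv, Matrix.mul_one]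

lemma frame_span_mul (hpq : p + q = n) {z : Matrix (Fin n) (Fin n) ℂ} (hz : z ∈ lieBallBoundary n p)
    {v : Matrix (Fin n) (Fin q) ℂ} (hv : v ∈ Fr n q) (h : z * cj v = v)
    {u : Matrix (Fin n) (Fin s) ℂ} (hu : z * cj u = u) : v * vᴴ * u = u := by
  apply Matrix.ext_of_mulVec_single
  intro i
  rw [← mulVec_mulVec]
  apply frame_span hpq hz hv h
  rw [mulVec_mulVec, frame_ker hu, zero_mulVec]

lemma frame_left {z : Matrix (Fin n) (Fin n) ℂ} (hz : zᵀ = z) {v : Matrix (Fin n) (Fin s) ℂ}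
    (h : z * cj v = v) : vᴴ * z = vᵀ := by
  have := congrArg Matrix.transpose h
  rwa [transpose_mul, hz, cj_transpose] at this

lemma frame_unique (hpq : p + q = n) {z : Matrix (Fin n) (Fin n) ℂ} (hz : z ∈ lieBallBoundary n p)
    {v u : Matrix (Fin n) (Fin q) ℂ} (hv : v ∈ Fr n q) (h : z * cj v = v)
    (hu : u ∈ Fr n q) (h' : z * cj u = u) : u * uᵀ = v * vᵀ := by
  have e := frame_span_mul hpq hz hv h h'
  have hB : vᴴ * u ∈ OC q := by
    constructor
    · rw [cj_mul, conjTranspose_cj, ← frame_left hz.1 h, Matrix.mul_assoc, h']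
    · rw [conjTranspose_mul, conjTranspose_conjTranspose, Matrix.mul_assoc, ← Matrix.mul_assoc v, e,
        show uᴴ * u = 1 from hu]
  have := (fiber_mul hv hB).2
  rwa [← Matrix.mul_assoc, e] at this

/-- The real subspace fixed by the antilinear involution. -/
def fixSub (z : Matrix (Fin n) (Fin n) ℂ) : Submodule ℝ (EuclideanSpace ℂ (Fin n)) where
  carrier := {w | z *ᵥ (star w.ofLp) = w.ofLp}
  add_mem' := by
    intro a b ha hb
    simp only [mem_ofPred_eq] at *
    simp [mulVec_add, ha, hb]
  zero_mem' := by simp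
  smul_mem' := by
    intro c a ha
    simp only [mem_ofPred_eq] at *
    have : star ((c • a).ofLp) = c • star a.ofLp := by
      ext i; simp
    rw [this, mulVec_smul, ha]; rfl

lemma exists_frame (hpq : p + q = n) {z : Matrix (Fin n) (Fin n) ℂ} (hz : z ∈ lieBallBoundary n p) :
    ∃ v ∈ Fr n q, z * cj v = v := by
  let S := fixSub z
  obtain ⟨s, ⟨b⟩⟩ : ∃ s, Nonempty (OrthonormalBasis (Fin s) ℝ S) := ⟨_, ⟨stdOrthonormalBasis ℝ S⟩⟩
  let v : Matrix (Fin n) (Fin s) ℂ := Matrix.of fun i j => (b j).1.ofLp i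
  have hbS : ∀ j, z *ᵥ (star (b j).1.ofLp) = (b j).1.ofLp := fun j => (b j).2
  have hzv : z * cj v = v := by
    ext i j
    exact congrFun (hbS j) i
  have hre : cj (vᴴ * v) = vᴴ * v := by
    rw [cj_mul, conjTranspose_cj, ← frame_left hz.1 hzv, Matrix.mul_assoc, hzv]
  have hv : v ∈ Fr n _ := by
    show vᴴ * v = 1
    ext i j
    have h1 : ((vᴴ * v) i j).re = (1 : Matrix (Fin s) (Fin s) ℝ) i j := by
      have := orthonormal_iff_ite.1 b.orthonormal i j
      rw [Matrix.one_apply, ← this, Submodule.coe_inner]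
      simp [v, Matrix.mul_apply, PiLp.inner_apply, mul_comm]
    have h2 := congrFun (congrFun hre i) j
    have h3 := Complex.conj_eq_iff_re.1 h2
    rw [← h3, h1]
    by_cases hij : i = j <;> simp [Matrix.one_apply, hij]
  have hr : LinearMap.range v.mulVecLin = LinearMap.ker (1 - z * cj z).mulVecLin := by
    apply le_antisymm (range_le_ker hzv)
    intro w hw
    have hw' : z *ᵥ (cj z *ᵥ w) = w := by
      have : (1 - z * cj z) *ᵥ w = 0 := hw
      rw [sub_mulVec, one_mulVec, sub_eq_zero] at this
      rw [mulVec_mulVec]; exact this.symm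
    have hstar : ∀ x : Fin n → ℂ, star (z *ᵥ star x) = cj z *ᵥ x := by
      intro x
      ext i
      simp [mulVec, dotProduct, cj]
    -- elements of `S` lie in the range
    have hS : ∀ x : Fin n → ℂ, z *ᵥ star x = x → x ∈ LinearMap.range v.mulVecLin := by
      intro x hx
      let x' : S := ⟨WithLp.toLp 2 x, hx⟩
      refine ⟨fun j => ((b.repr x' j : ℝ) : ℂ), ?_⟩
      have h1 := congrArg (fun y : S => y.1.ofLp) (b.sum_repr x')
      ext i
      have h2 := congrFun h1 i
      simp only [x'] at h2
      rw [← h2, Submodule.coe_sum, WithLp.ofLp_sum, Finset.sum_apply, mulVecLin_apply]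
      unfold mulVec dotProduct
      refine Finset.sum_congr rfl fun j _ => ?_
      rw [mul_comm]
      rfl
    have hS2 : ∀ x : Fin n → ℂ, z *ᵥ (cj z *ᵥ x) = x → x + z *ᵥ star x ∈ LinearMap.range v.mulVecLin := by
      intro x hx
      apply hS
      rw [star_add, mulVec_add, hstar, hx, add_comm]
    have ha := hS2 w hw'
    have hb := hS2 (Complex.I • w) (by rw [mulVec_smul, mulVec_smul, hw'])
    have : w = (1/2 : ℂ) • ((w + z *ᵥ star w) - Complex.I • (Complex.I • w + z *ᵥ star (Complex.I • w))) := by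
      rw [star_smul, mulVec_smul]
      ext i
      simp only [Pi.smul_apply, Pi.sub_apply, Pi.add_apply, smul_eq_mul, Complex.star_def,
        Complex.conj_I]
      linear_combination (1/2 * (w i - (z *ᵥ star w) i)) * Complex.I_mul_I
    rw [this]
    exact Submodule.smul_mem _ _ (Submodule.sub_mem _ ha (Submodule.smul_mem _ _ hb))
  have hs : s = q := by
    have h1 := rank_add_ker (1 - z * cj z)
    rw [(mem_R.1 hz).2.2, ← hr, finrank_range_frame hv] at h1
    omega
  subst hs
  exact ⟨v, hv, hzv⟩

end retr
end LieBall

namespace LieBall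
open Set Topology unitInterval

section retr2
variable {n q p : ℕ}

lemma proj_posSemidef {v : Matrix (Fin n) (Fin q) ℂ} (hv : v ∈ Fr n q) :
    (1 - v * vᴴ).PosSemidef := by
  have : (1 - v * vᴴ) = (1 - v * vᴴ)ᴴ * (1 - v * vᴴ) := by
    rw [conjTranspose_sub, conjTranspose_one, conjTranspose_mul, conjTranspose_conjTranspose,
      Matrix.mul_sub, Matrix.mul_one, Matrix.sub_mul, Matrix.one_mul, Matrix.mul_assoc v vᴴ,
      ← Matrix.mul_assoc vᴴ, show vᴴ * v = 1 from hv, Matrix.one_mul, sub_self, sub_zero]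
  rw [this]
  exact posSemidef_conjTranspose_mul_self _

lemma proj_ker {v : Matrix (Fin n) (Fin q) ℂ} {w : Fin n → ℂ} :
    (1 - v * vᴴ) *ᵥ w = 0 ↔ (v * vᴴ) *ᵥ w = w := by
  rw [sub_mulVec, one_mulVec, sub_eq_zero, eq_comm]

lemma frame_pt {v : Matrix (Fin n) (Fin q) ℂ} (hv : v ∈ Fr n q) : v * vᵀ * cj v = v := by
  rw [Matrix.mul_assoc, frame_transpose hv, Matrix.mul_one]

lemma frame_mem (hpq : p + q = n) {v : Matrix (Fin n) (Fin q) ℂ} (hv : v ∈ Fr n q) :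
    v * vᵀ ∈ lieBallBoundary n p := by
  rw [mem_R, sq_cj hv]
  refine ⟨by rw [transpose_mul, transpose_transpose], proj_posSemidef hv, ?_⟩
  have h1 := rank_add_ker (1 - v * vᴴ)
  have h2 : LinearMap.ker (1 - v * vᴴ).mulVecLin = LinearMap.range v.mulVecLin := by
    apply le_antisymm
    · intro w hw
      have := proj_ker.1 (show (1 - v * vᴴ) *ᵥ w = 0 from hw)
      exact ⟨vᴴ *ᵥ w, by rw [mulVecLin_apply, mulVec_mulVec, this]⟩
    · have := range_le_ker (frame_pt hv)
      rwa [sq_cj hv] at this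
  rw [h2, finrank_range_frame hv] at h1
  omega

lemma line_mem (hpq : p + q = n) {z : Matrix (Fin n) (Fin n) ℂ} (hz : z ∈ lieBallBoundary n p)
    {v : Matrix (Fin n) (Fin q) ℂ} (hv : v ∈ Fr n q) (h : z * cj v = v) {t : ℝ} (ht : t ∈ Icc (0:ℝ) 1) :
    (1 - t) • z + t • (v * vᵀ) ∈ lieBallBoundary n p := by
  have hcs : ∀ (c : ℝ) (A : Matrix (Fin n) (Fin n) ℂ), cj (c • A) = c • cj A := by
    intro c A; ext i j; simp [cj]
  have e1 : z * cj (v * vᵀ) = v * vᴴ := by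
    rw [cj_mul, transpose_cj, ← Matrix.mul_assoc, h]
  have e2 : v * vᵀ * cj z = v * vᴴ := by
    have h2 := congrArg cj (frame_left hz.1 h)
    rw [cj_mul, conjTranspose_cj, transpose_cj] at h2
    rw [Matrix.mul_assoc, h2]
  have e : 1 - ((1 - t) • z + t • (v * vᵀ)) * cj ((1 - t) • z + t • (v * vᵀ)) =
      ((1-t)^2) • (1 - z * cj z) + (1 - (1-t)^2) • (1 - v * vᴴ) := by
    rw [cj_add, hcs, hcs]
    simp only [Matrix.add_mul, Matrix.mul_add, Matrix.smul_mul, Matrix.mul_smul, e1, e2, sq_cj hv]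
    module
  have h0 : 0 ≤ 1 - (1-t)^2 := by nlinarith [ht.1, ht.2]
  obtain ⟨hzt, hM, hr⟩ := mem_R.1 hz
  have hQ := proj_posSemidef hv
  have hM' := hM.smul (sq_nonneg (1 - t))
  have hQ' := hQ.smul h0
  rw [mem_R, e]
  refine ⟨?_, hM'.add hQ', ?_⟩
  · rw [transpose_add, transpose_smul, transpose_smul, hzt, transpose_mul, transpose_transpose]
  rw [← hr]
  apply rank_congr
  intro w
  constructor
  · intro hw
    have hw2 : star w ⬝ᵥ ((((1-t)^2) • (1 - z * cj z)) *ᵥ w) + star w ⬝ᵥ (((1 - (1-t)^2) • (1 - v * vᴴ)) *ᵥ w) = 0 := by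
      rw [← dotProduct_add, ← add_mulVec, hw, dotProduct_zero]
    have a1 := hM'.dotProduct_mulVec_nonneg w
    have a2 := hQ'.dotProduct_mulVec_nonneg w
    obtain ⟨b1, b2⟩ := (add_eq_zero_iff_of_nonneg a1 a2).1 hw2
    rw [hM'.dotProduct_mulVec_zero_iff] at b1
    rw [hQ'.dotProduct_mulVec_zero_iff] at b2
    rw [smul_mulVec] at b1 b2
    by_cases ht1 : (1 - t)^2 = 0
    · rw [ht1, sub_zero, one_smul] at b2
      rw [← proj_ker.1 b2, ← mulVec_mulVec, mulVec_mulVec, frame_ker h, zero_mulVec]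
    · exact (smul_eq_zero.1 b1).resolve_left ht1
  · intro hw
    rw [add_mulVec, smul_mulVec, smul_mulVec, hw, proj_ker.2 (frame_span hpq hz hv h hw), smul_zero,
      smul_zero, add_zero]

open Classical in
/-- The retraction onto the deepest part. -/
noncomputable def PP (q : ℕ) (z : Matrix (Fin n) (Fin n) ℂ) : Matrix (Fin n) (Fin n) ℂ :=
  if h : ∃ v ∈ Fr n q, z * cj v = v then h.choose * h.chooseᵀ else 0

lemma PP_spec (hpq : p + q = n) {z : Matrix (Fin n) (Fin n) ℂ} (hz : z ∈ lieBallBoundary n p)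
    {v : Matrix (Fin n) (Fin q) ℂ} (hv : v ∈ Fr n q) (h : z * cj v = v) : PP q z = v * vᵀ := by
  have he : ∃ v ∈ Fr n q, z * cj v = v := ⟨v, hv, h⟩
  rw [PP, dif_pos he]
  exact frame_unique hpq hz hv h he.choose_spec.1 he.choose_spec.2

lemma PP_frame (hpq : p + q = n) {v : Matrix (Fin n) (Fin q) ℂ} (hv : v ∈ Fr n q) :
    PP q (v * vᵀ) = v * vᵀ := PP_spec hpq (frame_mem hpq hv) hv (frame_pt hv)

lemma PP_exists (hpq : p + q = n) {z : Matrix (Fin n) (Fin n) ℂ} (hz : z ∈ lieBallBoundary n p) :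
    ∃ v ∈ Fr n q, v * vᵀ = PP q z := by
  obtain ⟨v, hv, h⟩ := exists_frame hpq hz
  exact ⟨v, hv, (PP_spec hpq hz hv h).symm⟩

lemma PP_line (hpq : p + q = n) {z : Matrix (Fin n) (Fin n) ℂ} (hz : z ∈ lieBallBoundary n p)
    {t : ℝ} (ht : t ∈ Icc (0:ℝ) 1) : (1 - t) • z + t • PP q z ∈ lieBallBoundary n p := by
  obtain ⟨v, hv, h⟩ := exists_frame hpq hz
  rw [PP_spec hpq hz hv h]
  exact line_mem hpq hz hv h ht

lemma PP_continuous (hpq : p + q = n) :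
    Continuous fun z : lieBallBoundary n p => PP q z.1 := by
  have : CompactSpace (Fr n q) := isCompact_iff_compactSpace.1 isCompact_Fr
  rw [continuous_iff_isClosed]
  intro C hC
  have : (fun z : lieBallBoundary n p => PP q z.1) ⁻¹' C = Prod.fst ''
      {x : lieBallBoundary n p × Fr n q | x.1.1 * cj x.2.1 = x.2.1 ∧ x.2.1 * (x.2.1)ᵀ ∈ C} := by
    ext z
    constructor
    · intro hz
      obtain ⟨v, hv, h⟩ := exists_frame hpq z.2
      refine ⟨(z, ⟨v, hv⟩), ⟨h, ?_⟩, rfl⟩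
      have := PP_spec hpq z.2 hv h
      simp only [← this]
      exact hz
    · rintro ⟨⟨z, v⟩, ⟨h1, h2⟩, rfl⟩
      rw [mem_preimage, PP_spec hpq z.2 v.2 h1]
      exact h2
  rw [this]
  apply isClosedMap_fst_of_compactSpace
  have hc : Continuous fun x : lieBallBoundary n p × Fr n q => cj x.2.1 :=
    continuous_cj.comp (by fun_prop)
  exact (isClosed_eq (by fun_prop) (by fun_prop)).inter (hC.preimage (by fun_prop))

end retr2
end LieBall

namespace LieBall
open Set Topology unitInterval

section final
variable {n q p : ℕ}

lemma sign_const {f : I → ℂ} (hf : Continuous f) (h : ∀ t, f t = 1 ∨ f t = -1) : f 0 = f 1 := by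
  by_contra hne
  have hz : (0:ℝ) ∈ range (fun t => (f t).re) := by
    have hp := isPreconnected_range (Complex.continuous_re.comp hf)
    rcases h 0 with h0 | h0 <;> rcases h 1 with h1 | h1
    · exact absurd (h0.trans h1.symm) hne
    · exact hp.Icc_subset (a := -1) (b := 1) ⟨1, by simp [h1]⟩ ⟨0, by simp [h0]⟩ (by norm_num)
    · exact hp.Icc_subset (a := -1) (b := 1) ⟨0, by simp [h0]⟩ ⟨1, by simp [h1]⟩ (by norm_num)
    · exact absurd (h0.trans h1.symm) hne
  obtain ⟨t, ht⟩ := hz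
  rcases h t with h | h <;> simp [h] at ht

lemma homotopic_of_lift {X Y : Type*} [TopologicalSpace X] [TopologicalSpace Y]
    [SimplyConnectedSpace Y] (φ : C(Y, X)) {v0 a b : Y} {x : X} (γ γ' : Path (φ v0) x)
    (g : Path v0 a) (g' : Path v0 b) (δ : Path a b) (hg : ∀ t, φ (g t) = γ t)
    (hg' : ∀ t, φ (g' t) = γ' t) (hδ : ∀ t, φ (δ t) = x) : γ.Homotopic γ' := by
  have ha : φ a = x := by simpa using hδ 0
  subst ha
  have hb : φ b = φ a := by simpa using hδ 1
  have h1 : (g.trans δ).Homotopic g' := SimplyConnectedSpace.paths_homotopic _ _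
  have h2 := (h1.map φ).pathCast rfl hb.symm
  have e1 : ((g'.map φ.continuous).cast rfl hb.symm) = γ' := by
    ext t; exact hg' t
  have e2 : (((g.trans δ).map φ.continuous).cast rfl hb.symm) = γ.trans (Path.refl _) := by
    ext t
    simp only [Path.cast_coe, Path.map_coe, Function.comp_apply, Path.trans_apply]
    split_ifs
    · exact hg _
    · exact hδ _
  rw [e1, e2] at h2
  exact (Path.Homotopic.symm ⟨Path.Homotopy.transRefl γ⟩).trans h2

/-- The map from frames to the stratum. -/
def frMap (hpq : p + q = n) : C(Fr n q, lieBallBoundary n p) :=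
  ⟨fun v => ⟨v.1 * v.1ᵀ, frame_mem hpq v.2⟩, by fun_prop⟩

lemma PP_mem (hpq : p + q = n) (z : lieBallBoundary n p) : PP q z.1 ∈ lieBallBoundary n p := by
  obtain ⟨v, hv, h⟩ := PP_exists hpq z.2
  rw [← h]
  exact frame_mem hpq hv

/-- The retraction as a map of the stratum. -/
noncomputable def retr (hpq : p + q = n) : C(lieBallBoundary n p, lieBallBoundary n p) :=
  ⟨fun z => ⟨PP q z.1, PP_mem hpq z⟩, (PP_continuous hpq).subtype_mk _⟩

lemma retr_frMap (hpq : p + q = n) (v : Fr n q) : retr hpq (frMap hpq v) = frMap hpq v :=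
  Subtype.ext (PP_frame hpq v.2)

lemma joined_retr (hpq : p + q = n) (z : lieBallBoundary n p) : Joined z (retr hpq z) := by
  refine ⟨⟨⟨fun t => ⟨(1 - (t:ℝ)) • z.1 + (t:ℝ) • PP q z.1, PP_line hpq z.2 t.2⟩, ?_⟩, ?_, ?_⟩⟩
  · fun_prop
  · apply Subtype.ext; simp
  · apply Subtype.ext; simp [retr]

lemma exists_frMap (hpq : p + q = n) (z : lieBallBoundary n p) : ∃ v, frMap hpq v = retr hpq z := by
  obtain ⟨v, hv, h⟩ := PP_exists hpq z.2
  exact ⟨⟨v, hv⟩, Subtype.ext h⟩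

theorem pathConnected_R (hpq : p + q = n) (hq : 0 < q) (hp : 0 < p) :
    PathConnectedSpace (lieBallBoundary n p) := by
  have := simplyConnected_Fr (n := n) hq (by omega)
  obtain ⟨v0⟩ : Nonempty (Fr n q) := inferInstance
  refine ⟨⟨frMap hpq v0⟩, fun x y => ?_⟩
  obtain ⟨v, hv⟩ := exists_frMap hpq x
  obtain ⟨w, hw⟩ := exists_frMap hpq y
  have h1 := joined_retr hpq x
  have h2 := joined_retr hpq y
  rw [← hv] at h1
  rw [← hw] at h2
  have h3 : Joined (frMap hpq v) (frMap hpq w) :=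
    ⟨(PathConnectedSpace.somePath v w).map (frMap hpq).continuous⟩
  exact h1.trans (h3.trans h2.symm)

/-- The retracted loop. -/
noncomputable def rloop (hpq : p + q = n) {v0 : Fr n q} (γ : Path (frMap hpq v0) (frMap hpq v0)) :
    Path (frMap hpq v0) (frMap hpq v0) :=
  (γ.map (retr hpq).continuous).cast (retr_frMap hpq v0).symm (retr_frMap hpq v0).symm

lemma rloop_homotopic (hpq : p + q = n) {v0 : Fr n q} (γ : Path (frMap hpq v0) (frMap hpq v0)) :
    γ.Homotopic (rloop hpq γ) := by
  have hPc := PP_continuous (n := n) (p := p) hpq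
  refine ⟨⟨⟨⟨fun x => ⟨(1 - (x.1:ℝ)) • (γ x.2).1 + (x.1:ℝ) • PP q (γ x.2).1,
    PP_line hpq (γ x.2).2 x.1.2⟩, ?_⟩, ?_, ?_⟩, ?_⟩⟩
  · have : Continuous fun x : I × I => PP q (γ x.2).1 := hPc.comp (by fun_prop)
    fun_prop
  · intro t; apply Subtype.ext; simp
  · intro t; apply Subtype.ext; simp [rloop]; rfl
  · intro s t ht
    have hPv : PP q (frMap hpq v0).1 = (frMap hpq v0).1 := PP_frame hpq v0.2
    apply Subtype.ext
    rcases ht with rfl | rfl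
    · simp only [ContinuousMap.coe_mk, γ.source, hPv]
      simp only [Path.coe_toContinuousMap, γ.source]
      module
    · simp only [ContinuousMap.coe_mk, γ.target, hPv]
      simp only [Path.coe_toContinuousMap, γ.target]
      module

/-- Lifts of loops to paths of frames. -/
def Lifts (hpq : p + q = n) {v0 : Fr n q} (γ : Path (frMap hpq v0) (frMap hpq v0)) (g : C(I, Fr n q)) : Prop :=
  g 0 = v0 ∧ ∀ t, frMap hpq (g t) = retr hpq (γ t)

lemma end_fiber (hpq : p + q = n) {v0 w : Fr n q} (h : frMap hpq w = frMap hpq v0) :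
    v0.1ᴴ * w.1 ∈ OC q ∧ w.1 = v0.1 * (v0.1ᴴ * w.1) :=
  fiber v0.2 w.2 (congrArg Subtype.val h).symm

lemma Lifts.fiber_end {hpq : p + q = n} {v0 : Fr n q} {γ : Path (frMap hpq v0) (frMap hpq v0)}
    {g : C(I, Fr n q)} (h : Lifts hpq γ g) : frMap hpq (g 1) = frMap hpq v0 := by
  rw [h.2, γ.target, retr_frMap]

lemma homotopy_lift (hpq : p + q = n) {v0 : Fr n q} {γ γ' : Path (frMap hpq v0) (frMap hpq v0)}
    (h : γ.Homotopic γ') : ∃ g g' : C(I, Fr n q), Lifts hpq γ g ∧ Lifts hpq γ' g' ∧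
      (v0.1ᴴ * (g 1).1).det = (v0.1ᴴ * (g' 1).1).det := by
  obtain ⟨H⟩ := h
  obtain ⟨G, hG, hGF, hGl, hG0⟩ := exists_lift (K := I) (q := q) (F := fun x => PP q (H x).1)
    ((PP_continuous hpq).comp H.continuous) (fun x => PP_exists hpq (H x).2)
    (g0 := fun _ => v0.1) continuous_const (fun _ => v0.2) (by
      intro k
      simp only [Path.Homotopy.source]
      exact (PP_frame hpq v0.2).symm)
  refine ⟨⟨fun t => ⟨G (0, t), hGF _⟩, by fun_prop⟩, ⟨fun t => ⟨G (1, t), hGF _⟩, by fun_prop⟩,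
    ⟨Subtype.ext (hG0 0), fun t => Subtype.ext ?_⟩, ⟨Subtype.ext (hG0 1), fun t => Subtype.ext ?_⟩, ?_⟩
  · refine (hGl (0, t)).trans ?_
    simp [retr]
  · refine (hGl (1, t)).trans ?_
    simp [retr]
  · refine sign_const (f := fun s => (v0.1ᴴ * G (s, 1)).det) (by fun_prop) fun s => ?_
    refine OC_det (fiber v0.2 (hGF _) ?_).1
    rw [hGl]
    simp only [Path.Homotopy.target]
    exact (PP_frame hpq v0.2).symm

lemma Lifts.det_eq {hpq : p + q = n} {v0 : Fr n q} {γ : Path (frMap hpq v0) (frMap hpq v0)}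
    {g g' : C(I, Fr n q)} (h : Lifts hpq γ g) (h' : Lifts hpq γ g') :
    (v0.1ᴴ * (g 1).1).det = (v0.1ᴴ * (g' 1).1).det := by
  have hf : ∀ t, frMap hpq (g' t) = frMap hpq (g t) := fun t => by rw [h.2, h'.2]
  have hs := sign_const (f := fun t => ((g t).1ᴴ * (g' t).1).det) (by fun_prop)
    fun t => OC_det (end_fiber hpq (hf t)).1
  have h0 : (g 0).1ᴴ * (g' 0).1 = 1 := by
    rw [h.1, h'.1]; exact v0.2
  simp only [h0, det_one] at hs
  rw [(end_fiber hpq (hf 1)).2, ← Matrix.mul_assoc, det_mul (v0.1ᴴ * (g 1).1), ← hs, mul_one]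

lemma Lifts.homotopic {hpq : p + q = n} [SimplyConnectedSpace (Fr n q)] {v0 : Fr n q}
    {γ γ' : Path (frMap hpq v0) (frMap hpq v0)} {g g' : C(I, Fr n q)} (h : Lifts hpq γ g)
    (h' : Lifts hpq γ' g') (hd : (v0.1ᴴ * (g 1).1).det = (v0.1ᴴ * (g' 1).1).det) :
    γ.Homotopic γ' := by
  refine (rloop_homotopic hpq γ).trans (Path.Homotopic.trans ?_ (rloop_homotopic hpq γ').symm)
  obtain ⟨hB, hBe⟩ := end_fiber hpq (h'.fiber_end.trans h.fiber_end.symm)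
  obtain ⟨hA, hAe⟩ := end_fiber hpq h.fiber_end
  have hBd : ((g 1).1ᴴ * (g' 1).1).det = 1 := by
    rw [hBe, ← Matrix.mul_assoc, det_mul] at hd
    have : (v0.1ᴴ * (g 1).1).det ≠ 0 := by
      rcases OC_det hA with h | h <;> rw [h] <;> norm_num
    exact mul_left_cancel₀ this (by rw [mul_one]; exact hd.symm)
  obtain ⟨c, hc⟩ := (OC_joined_of_det hB hBd).symm
  let δ : Path (g 1) (g' 1) := ⟨⟨fun t => ⟨(g 1).1 * c t, (fiber_mul (g 1).2 (hc t)).1⟩, by fun_prop⟩,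
    Subtype.ext (by simp), Subtype.ext (by simpa using hBe.symm)⟩
  refine homotopic_of_lift (frMap hpq) (rloop hpq γ) (rloop hpq γ') (a := g 1) (b := g' 1)
    ⟨g, h.1, rfl⟩ ⟨g', h'.1, rfl⟩ δ (fun t => h.2 t) (fun t => h'.2 t) fun t => ?_
  rw [← h.fiber_end]
  exact Subtype.ext (fiber_mul (g 1).2 (hc t)).2

lemma exists_loop (hpq : p + q = n) [SimplyConnectedSpace (Fr n q)] (v0 : Fr n q)
    {D : Matrix (Fin q) (Fin q) ℂ} (hD : D ∈ OC q) :
    ∃ γ : Path (frMap hpq v0) (frMap hpq v0), ∃ g, Lifts hpq γ g ∧ (v0.1ᴴ * (g 1).1).det = D.det := by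
  let w : Fr n q := ⟨v0.1 * D, (fiber_mul v0.2 hD).1⟩
  have hw : frMap hpq w = frMap hpq v0 := Subtype.ext (fiber_mul v0.2 hD).2
  let g := PathConnectedSpace.somePath v0 w
  refine ⟨(g.map (frMap hpq).continuous).cast rfl hw.symm, g.toContinuousMap, ⟨g.source, fun t => ?_⟩, ?_⟩
  · exact (retr_frMap hpq (g t)).symm
  · have : g.toContinuousMap 1 = w := g.target
    rw [this]
    simp only [w]
    rw [← Matrix.mul_assoc, show v0.1ᴴ * v0.1 = 1 from v0.2, Matrix.one_mul]

theorem card_pi1 (hpq : p + q = n) (hq : 0 < q) (hp : 0 < p) :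
    ∃ x : lieBallBoundary n p, Nat.card (FundamentalGroup (lieBallBoundary n p) x) = 2 := by
  have := simplyConnected_Fr (n := n) hq (by omega)
  obtain ⟨v0⟩ : Nonempty (Fr n q) := inferInstance
  refine ⟨frMap hpq v0, ?_⟩
  obtain ⟨D, hD, hDd⟩ := OC_exists_neg hq
  have h1 : (1 : Matrix (Fin q) (Fin q) ℂ) ∈ OC q :=
    ⟨cj_one, by rw [conjTranspose_one, Matrix.one_mul]⟩
  obtain ⟨γ1, g1, hg1, hd1⟩ := exists_loop hpq v0 h1
  obtain ⟨γ2, g2, hg2, hd2⟩ := exists_loop hpq v0 hD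
  rw [det_one] at hd1
  rw [hDd] at hd2
  change Nat.card (Path.Homotopic.Quotient (frMap hpq v0) (frMap hpq v0)) = 2
  rw [Nat.card_eq_two_iff]
  refine ⟨Path.Homotopic.Quotient.mk γ1, Path.Homotopic.Quotient.mk γ2, ?_, ?_⟩
  · intro h
    have hh := Path.Homotopic.Quotient.exact h
    obtain ⟨a, b, ha, hb, hab⟩ := homotopy_lift hpq hh
    rw [ha.det_eq hg1, hb.det_eq hg2, hd1, hd2] at hab
    norm_num at hab
  · rw [eq_univ_iff_forall]
    intro x
    obtain ⟨γ, rfl⟩ := Path.Homotopic.Quotient.mk_surjective x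
    obtain ⟨g, -, hg, -, -⟩ := homotopy_lift hpq (Path.Homotopic.refl γ)
    rcases OC_det (end_fiber hpq hg.fiber_end).1 with h | h
    · left
      exact Path.Homotopic.Quotient.eq.2 (hg.homotopic hg1 (h.trans hd1.symm))
    · right
      exact Path.Homotopic.Quotient.eq.2 (hg.homotopic hg2 (h.trans hd2.symm))

end final
end LieBall

/-- For `n ≥ 2` and `0 < p < n`, the boundary manifold `ℛ_{p,0}` is path-connected with
fundamental group `ℤ/2`. -/
theorem lieBallBoundary_fundamentalGroup (n p : ℕ) (hn : 2 ≤ n) (hp : 0 < p) (hpn : p < n) :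
    PathConnectedSpace (lieBallBoundary n p) ∧
    ∀ x : lieBallBoundary n p,
      Nonempty (FundamentalGroup (lieBallBoundary n p) x ≃* Multiplicative (ZMod 2)) := by
  have hpq : p + (n - p) = n := by omega
  have hpc := LieBall.pathConnected_R hpq (by omega) hp
  refine ⟨hpc, fun x => ?_⟩
  obtain ⟨x1, hx1⟩ := LieBall.card_pi1 hpq (by omega) hp
  have h2 : Nat.card (Multiplicative (ZMod 2)) = 2 := by simp
  have : Fact (Nat.Prime 2) := ⟨Nat.prime_two⟩
  exact ⟨(FundamentalGroup.fundamentalGroupMulEquivOfPathConnected x x1).trans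
    (mulEquivOfPrimeCardEq hx1 h2)⟩
end

section
/- The Cayley transformation γ(z) := (z − 1)·(z + 1)⁻¹ is a well-defined bijection from ℋ onto 𝔻 with inverse w ↦ (1 + w)·(1 − w)⁻¹: for every z ∈ ℋ the matrix z + 1 is invertible, γ(z) is symmetric and lies in 𝔻; for every w ∈ 𝔻 the matrix 1 − w is invertible and (1 + w)·(1 − w)⁻¹ lies in ℋ; and the two maps are mutually inverse. -/
open Matrix
open scoped ComplexOrder

/-- Siegel's upper half plane (up to the factor `i`): the tube domain `ℋ = Ω ⊕ iV` of
symmetric complex `n×n` matrices `z` with `z + z̄` positive definite. -/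
def siegelTube (n : ℕ) : Set (Matrix (Fin n) (Fin n) ℂ) :=
  {z | zᵀ = z ∧ (z + z.map (starRingEnd ℂ)).PosDef}

/-- The Lie ball `𝔻`: symmetric complex `n×n` matrices `w` with `1 − w·w̄` positive
definite. -/
def lieBall (n : ℕ) : Set (Matrix (Fin n) (Fin n) ℂ) :=
  {w | wᵀ = w ∧ (1 - w * w.map (starRingEnd ℂ)).PosDef}

theorem cb_isUnit {n : ℕ} (A : Matrix (Fin n) (Fin n) ℂ) (h : (A + Aᴴ).PosDef) : IsUnit A := by
  rw [← Matrix.mulVec_injective_iff_isUnit]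
  refine (injective_iff_map_eq_zero (Matrix.mulVecLin A)).2 ?_
  intro v hv
  by_contra hne
  have hv' : A *ᵥ v = 0 := hv
  have h1 := h.dotProduct_mulVec_pos hne
  have h2 : star v ᵥ* Aᴴ = 0 := by rw [← Matrix.star_mulVec, hv', star_zero]
  rw [Matrix.add_mulVec, hv', zero_add, Matrix.dotProduct_mulVec, h2, zero_dotProduct] at h1
  exact lt_irrefl _ h1

theorem cb_map {n : ℕ} {z : Matrix (Fin n) (Fin n) ℂ} (h : zᵀ = z) :
    z.map (starRingEnd ℂ) = zᴴ := by
  conv_rhs => rw [← h]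
  ext i j
  simp [Matrix.conjTranspose_apply]

theorem cb_two {n : ℕ} {M : Matrix (Fin n) (Fin n) ℂ} (h : M.PosDef) : (M + M).PosDef :=
  h.add h

theorem cb_conj {n : ℕ} {M B C : Matrix (Fin n) (Fin n) ℂ} (h : M.PosDef) (hB : B * C = 1) :
    (B * M * Bᴴ).PosDef :=
  (Matrix.IsUnit.posDef_star_right_conjugate_iff (IsUnit.of_mul_eq_one C hB)).2 h

theorem cb_unit1 {n : ℕ} {z : Matrix (Fin n) (Fin n) ℂ} (hz : z ∈ siegelTube n) :
    IsUnit (z + 1) := by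
  obtain ⟨h1, h2⟩ := hz
  rw [cb_map h1] at h2
  apply cb_isUnit
  have : z + 1 + (z + 1)ᴴ = (z + zᴴ) + (1 + 1) := by
    simp only [conjTranspose_add, conjTranspose_one]; abel
  rw [this]
  exact h2.add (cb_two PosDef.one)

theorem cb_unit2 {n : ℕ} {w : Matrix (Fin n) (Fin n) ℂ} (hw : w ∈ lieBall n) :
    IsUnit (1 - w) := by
  obtain ⟨h1, h2⟩ := hw
  rw [cb_map h1] at h2
  apply cb_isUnit
  have : 1 - w + (1 - w)ᴴ = (1 - w * wᴴ) + (1 - w) * (1 - w)ᴴ := by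
    simp only [conjTranspose_sub, conjTranspose_one]; noncomm_ring
  rw [this]
  exact h2.add_posSemidef (posSemidef_self_mul_conjTranspose _)

/-- inverse data -/
theorem cb_inv {n : ℕ} {A : Matrix (Fin n) (Fin n) ℂ} (h : IsUnit A) (hs : Aᵀ = A) :
    A * A⁻¹ = 1 ∧ A⁻¹ * A = 1 ∧ (A⁻¹)ᵀ = A⁻¹ := by
  have hd := (Matrix.isUnit_iff_isUnit_det A).1 h
  exact ⟨mul_nonsing_inv A hd, nonsing_inv_mul A hd, by rw [transpose_nonsing_inv, hs]⟩

theorem cb_comm {n : ℕ} {A B X : Matrix (Fin n) (Fin n) ℂ} (h1 : A * B = 1) (h2 : B * A = 1)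
    (hc : A * X = X * A) : X * B = B * X := by
  calc X * B = (B * A) * X * B := by rw [h2, one_mul]
    _ = B * (A * X) * B := by noncomm_ring
    _ = B * X * (A * B) := by rw [hc]; noncomm_ring
    _ = B * X := by rw [h1, mul_one]

/-- The Cayley transformation `γ(z) = (z − 1)(z + 1)⁻¹` is a well-defined bijection
from `ℋ` onto `𝔻` with inverse `w ↦ (1 + w)(1 − w)⁻¹`. -/
theorem cayley_bijection (n : ℕ) (hn : 1 ≤ n) :
    (∀ z ∈ siegelTube n, IsUnit (z + 1) ∧ (z - 1) * (z + 1)⁻¹ ∈ lieBall n) ∧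
    (∀ w ∈ lieBall n, IsUnit (1 - w) ∧ (1 + w) * (1 - w)⁻¹ ∈ siegelTube n) ∧
    (∀ z ∈ siegelTube n,
      (1 + (z - 1) * (z + 1)⁻¹) * (1 - (z - 1) * (z + 1)⁻¹)⁻¹ = z) ∧
    (∀ w ∈ lieBall n,
      ((1 + w) * (1 - w)⁻¹ - 1) * ((1 + w) * (1 - w)⁻¹ + 1)⁻¹ = w) := by
  refine ⟨?_, ?_, ?_, ?_⟩
  · intro z hz
    have hu := cb_unit1 hz
    obtain ⟨hs, hp⟩ := hz
    obtain ⟨a, b, c⟩ := cb_inv hu (by simp [hs])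
    refine ⟨hu, ?_⟩
    generalize (z + 1)⁻¹ = B at a b c
    have hcm : (z - 1) * B = B * (z - 1) := cb_comm a b (by noncomm_ring)
    have hsy : ((z - 1) * B)ᵀ = (z - 1) * B := by
      rw [transpose_mul, c, transpose_sub, hs, transpose_one, hcm]
    refine ⟨hsy, ?_⟩
    rw [cb_map hs] at hp
    rw [cb_map hsy, hcm]
    have a' : (z + 1)ᴴ * Bᴴ = 1 := by rw [← conjTranspose_mul, b, conjTranspose_one]
    convert cb_conj (cb_two hp) b using 1
    calc 1 - B * (z - 1) * (B * (z - 1))ᴴ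
        = (B * (z + 1)) * ((z + 1)ᴴ * Bᴴ) - B * (z - 1) * (B * (z - 1))ᴴ := by
          rw [b, a', one_mul]
      _ = _ := by
          simp only [conjTranspose_mul, conjTranspose_sub, conjTranspose_add, conjTranspose_one]
          noncomm_ring
  · intro w hw
    have hu := cb_unit2 hw
    obtain ⟨hs, hp⟩ := hw
    obtain ⟨a, b, c⟩ := cb_inv hu (by simp [hs])
    refine ⟨hu, ?_⟩
    generalize (1 - w)⁻¹ = B at a b c
    have hcm : (1 + w) * B = B * (1 + w) := cb_comm a b (by noncomm_ring)
    have hsy : ((1 + w) * B)ᵀ = (1 + w) * B := by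
      rw [transpose_mul, c, transpose_add, hs, transpose_one, hcm]
    refine ⟨hsy, ?_⟩
    rw [cb_map hs] at hp
    rw [cb_map hsy, hcm]
    have a' : (1 - w)ᴴ * Bᴴ = 1 := by rw [← conjTranspose_mul, b, conjTranspose_one]
    convert cb_conj (cb_two hp) b using 1
    calc B * (1 + w) + (B * (1 + w))ᴴ
        = B * (1 + w) * ((1 - w)ᴴ * Bᴴ) + (B * (1 - w)) * (B * (1 + w))ᴴ := by
          rw [b, a', one_mul, mul_one]
      _ = _ := by
          simp only [conjTranspose_mul, conjTranspose_sub, conjTranspose_add, conjTranspose_one]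
          noncomm_ring
  · intro z hz
    have hu := cb_unit1 hz
    obtain ⟨a, b, -⟩ := cb_inv hu (by simp [hz.1])
    generalize (z + 1)⁻¹ = B at a b
    have e1 : 1 + (z - 1) * B = z * ((2 : ℂ) • B) := by
      have : 1 + (z - 1) * B = (z + 1) * B + (z - 1) * B := by rw [a]
      rw [this, two_smul]; noncomm_ring
    have e2 : 1 - (z - 1) * B = (2 : ℂ) • B := by
      have : 1 - (z - 1) * B = (z + 1) * B - (z - 1) * B := by rw [a]
      rw [this, two_smul]; noncomm_ring
    have hi : ((2 : ℂ) • B) * ((2 : ℂ)⁻¹ • (z + 1)) = 1 := by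
      rw [smul_mul_smul_comm, b]; norm_num
    rw [e1, e2, inv_eq_right_inv hi, mul_assoc, hi, mul_one]
  · intro w hw
    have hu := cb_unit2 hw
    obtain ⟨a, b, -⟩ := cb_inv hu (by simp [hw.1])
    generalize (1 - w)⁻¹ = B at a b
    have e1 : (1 + w) * B - 1 = w * ((2 : ℂ) • B) := by
      have : (1 + w) * B - 1 = (1 + w) * B - (1 - w) * B := by rw [a]
      rw [this, two_smul]; noncomm_ring
    have e2 : (1 + w) * B + 1 = (2 : ℂ) • B := by
      have : (1 + w) * B + 1 = (1 + w) * B + (1 - w) * B := by rw [a]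
      rw [this, two_smul]; noncomm_ring
    have hi : ((2 : ℂ) • B) * ((2 : ℂ)⁻¹ • (1 - w)) = 1 := by
      rw [smul_mul_smul_comm, b]; norm_num
    rw [e1, e2, inv_eq_right_inv hi, mul_assoc, hi, mul_one]
end

section
/- The Cayley transformation γ(z) := (z − 1)·(z + 1)⁻¹ restricts to a bijection from the tube 𝒯 over the future light cone onto {w ∈ ℛ : det(1 − w) ≠ 0}: for every z ∈ 𝒯 the matrix z + 1 is invertible and γ(z) lies in ℛ with det(1 − γ(z)) ≠ 0; conversely every w ∈ ℛ with det(1 − w) ≠ 0 equals γ(z) for a unique z ∈ 𝒯, namely z = (1 + w)·(1 − w)⁻¹. -/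
open Matrix Complex

/-- The tube `𝒯` over the future light cone, inside the space of symmetric
complex `2×2` matrices. -/
def lightConeTube : Set (Matrix (Fin 2) (Fin 2) ℂ) :=
  {z | zᵀ = z ∧ (z + z.map (starRingEnd ℂ)).det = 0 ∧ 0 < (Matrix.trace z).re}

/-- The smooth boundary part `ℛ` of the Lie ball in the space of symmetric complex
`2×2` matrices: `det(1 − w·w̄) = 0` and `tr(1 − w·w̄) > 0`. -/
def lieBallSmoothBoundary : Set (Matrix (Fin 2) (Fin 2) ℂ) :=
  {w | wᵀ = w ∧ (1 - w * w.map (starRingEnd ℂ)).det = 0 ∧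
    0 < (Matrix.trace (1 - w * w.map (starRingEnd ℂ))).re}

open scoped ComplexOrder in
lemma psd_aux {H : Matrix (Fin 2) (Fin 2) ℂ} (hH : Hᴴ = H) (hd : H.det = 0)
    (ht : 0 < (Matrix.trace H).re) : ∃ t : ℝ, 0 < t ∧ H = t • (H * Hᴴ) := by
  have e : ∀ i j, star (H j i) = H i j := fun i j => by
    rw [← Matrix.conjTranspose_apply, hH]
  have him : (Matrix.trace H).im = 0 := by
    have : star (Matrix.trace H) = Matrix.trace H := by
      rw [← Matrix.trace_conjTranspose, hH]
    exact Complex.conj_eq_iff_im.mp this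
  have hsq : H * H = Matrix.trace H • H := by
    rw [Matrix.det_fin_two] at hd
    ext i j
    fin_cases i <;> fin_cases j <;>
      simp [Matrix.mul_apply, Fin.sum_univ_two, Matrix.trace] <;>
      first | ring1 | linear_combination -hd
  refine ⟨(Matrix.trace H).re⁻¹, inv_pos.mpr ht, ?_⟩
  have htr : Matrix.trace H = ((Matrix.trace H).re : ℂ) := by
    apply Complex.ext <;> simp [him]
  have hsq' : H * H = (Matrix.trace H).re • H := by
    rw [hsq, htr]; ext i j; simp
  rw [hH, hsq', smul_smul, inv_mul_cancel₀ ht.ne', one_smul]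

open scoped ComplexOrder in
lemma trace_aux {H B : Matrix (Fin 2) (Fin 2) ℂ} (hH : Hᴴ = H) (hd : H.det = 0)
    (ht : 0 < (Matrix.trace H).re) (hB : B.det ≠ 0) :
    0 < (Matrix.trace (B * H * Bᴴ)).re := by
  obtain ⟨t, ht0, h⟩ := psd_aux hH hd ht
  have h1 : B * H * Bᴴ = t • ((B * H) * (B * H)ᴴ) := by
    conv_lhs => rw [h]
    simp [Matrix.conjTranspose_mul, Matrix.mul_assoc]
  have hne : Matrix.trace ((B * H) * (B * H)ᴴ) ≠ 0 := by
    intro h0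
    rw [Matrix.trace_mul_conjTranspose_self_eq_zero_iff] at h0
    have : H = 0 := by
      have := congrArg (B⁻¹ * ·) h0
      simpa [← Matrix.mul_assoc, Matrix.nonsing_inv_mul B (isUnit_iff_ne_zero.mpr hB)] using this
    simp [this] at ht
  have hnn := (Matrix.posSemidef_self_mul_conjTranspose (B * H)).trace_nonneg
  have hpos := lt_of_le_of_ne hnn hne.symm
  rw [h1, Matrix.trace_smul, Complex.smul_re]
  exact mul_pos ht0 (Complex.pos_iff.mp hpos).1

open scoped ComplexOrder in
lemma det_aux {z : Matrix (Fin 2) (Fin 2) ℂ} (hd : (z + zᴴ).det = 0)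
    (ht : 0 < (Matrix.trace (z + zᴴ)).re) : (z + 1).det ≠ 0 := by
  intro h0
  obtain ⟨v, hv, hz⟩ := Matrix.exists_mulVec_eq_zero_iff.mpr h0
  obtain ⟨t, ht0, h⟩ := psd_aux (by simp [add_comm]) hd ht
  have hp : (z + zᴴ).PosSemidef := by
    rw [h]
    exact (Matrix.posSemidef_self_mul_conjTranspose (z + zᴴ)).smul ht0.le
  have hq : ((z + zᴴ) + (1 + 1)).PosDef :=
    Matrix.PosDef.posSemidef_add hp (Matrix.PosDef.one.add Matrix.PosDef.one)
  have := hq.dotProduct_mulVec_pos hv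
  have e : (z + zᴴ) + (1 + 1) = (z + 1) + (z + 1)ᴴ := by
    simp; abel
  rw [e, Matrix.add_mulVec, hz, zero_add, Matrix.dotProduct_mulVec, ← Matrix.star_mulVec, hz] at this
  simp at this

lemma conj_aux {z : Matrix (Fin 2) (Fin 2) ℂ} (h : zᵀ = z) : z.map (starRingEnd ℂ) = zᴴ := by
  conv_lhs => rw [← h]
  rfl

lemma trace_add_aux (z : Matrix (Fin 2) (Fin 2) ℂ) :
    (Matrix.trace (z + zᴴ)).re = 2 * (Matrix.trace z).re := by
  rw [Matrix.trace_add, Matrix.trace_conjTranspose]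
  simp; ring

lemma inv_comm_aux {a b : Matrix (Fin 2) (Fin 2) ℂ} (hb : b.det ≠ 0) (h : a * b = b * a) :
    a * b⁻¹ = b⁻¹ * a := by
  have u : IsUnit b.det := isUnit_iff_ne_zero.mpr hb
  calc a * b⁻¹ = b⁻¹ * (b * a) * b⁻¹ := by
        rw [← Matrix.mul_assoc, Matrix.nonsing_inv_mul b u, Matrix.one_mul]
    _ = b⁻¹ * a := by
        rw [← h, Matrix.mul_assoc, Matrix.mul_assoc, Matrix.mul_nonsing_inv b u, Matrix.mul_one]

lemma conjugate_aux {b M : Matrix (Fin 2) (Fin 2) ℂ} (hb : b.det ≠ 0) :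
    b⁻¹ * (b * M * bᴴ) * (b⁻¹)ᴴ = M := by
  have u : IsUnit b.det := isUnit_iff_ne_zero.mpr hb
  have h1 : bᴴ * (b⁻¹)ᴴ = 1 := by
    rw [← Matrix.conjTranspose_mul, Matrix.nonsing_inv_mul b u, Matrix.conjTranspose_one]
  rw [Matrix.mul_assoc b, ← Matrix.mul_assoc b⁻¹, Matrix.nonsing_inv_mul b u, Matrix.one_mul,
    Matrix.mul_assoc, h1, Matrix.mul_one]

lemma inv_det_aux {b : Matrix (Fin 2) (Fin 2) ℂ} (hb : b.det ≠ 0) : (b⁻¹).det ≠ 0 := by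
  rw [Matrix.det_nonsing_inv]
  simpa using hb

/-- The Cayley transformation `γ(z) = (z − 1)(z + 1)⁻¹` restricts to a bijection from the
tube `𝒯` onto `{w ∈ ℛ : det(1 − w) ≠ 0}`, with inverse `w ↦ (1 + w)(1 − w)⁻¹`. -/
theorem cayley_tube_onto_boundary :
    (∀ z ∈ lightConeTube, IsUnit (z + 1) ∧
      (z - 1) * (z + 1)⁻¹ ∈ lieBallSmoothBoundary ∧
      (1 - (z - 1) * (z + 1)⁻¹).det ≠ 0) ∧
    (∀ w ∈ lieBallSmoothBoundary, (1 - w).det ≠ 0 →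
      ((1 + w) * (1 - w)⁻¹ ∈ lightConeTube ∧
        ((1 + w) * (1 - w)⁻¹ - 1) * ((1 + w) * (1 - w)⁻¹ + 1)⁻¹ = w ∧
        ∀ z ∈ lightConeTube, (z - 1) * (z + 1)⁻¹ = w → z = (1 + w) * (1 - w)⁻¹)) := by
  constructor
  · rintro z ⟨hs, hd, ht⟩
    rw [conj_aux hs] at hd
    have ht' : 0 < (Matrix.trace (z + zᴴ)).re := by rw [trace_add_aux]; linarith
    have hb : (z + 1).det ≠ 0 := det_aux hd ht'
    have u : IsUnit (z + 1).det := isUnit_iff_ne_zero.mpr hb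
    have hcomm : (z - 1) * (z + 1)⁻¹ = (z + 1)⁻¹ * (z - 1) :=
      inv_comm_aux hb (by noncomm_ring)
    have hmul : (z - 1) * (z + 1)⁻¹ * (z + 1) = z - 1 := by
      rw [Matrix.mul_assoc, Matrix.nonsing_inv_mul _ u, Matrix.mul_one]
    have hmul' : (z + 1) * ((z - 1) * (z + 1)⁻¹) = z - 1 := by
      rw [hcomm, ← Matrix.mul_assoc, Matrix.mul_nonsing_inv _ u, Matrix.one_mul]
    have hws : ((z - 1) * (z + 1)⁻¹)ᵀ = (z - 1) * (z + 1)⁻¹ := by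
      rw [Matrix.transpose_mul, Matrix.transpose_nonsing_inv]
      simp only [Matrix.transpose_add, Matrix.transpose_sub, hs, Matrix.transpose_one]
      exact hcomm.symm
    refine ⟨(Matrix.isUnit_iff_isUnit_det _).mpr u, ?_, ?_⟩
    · generalize (z - 1) * (z + 1)⁻¹ = w at *
      have key : (z + 1) * (1 - w * wᴴ) * (z + 1)ᴴ = (2 : ℝ) • (z + zᴴ) := by
        have h2 : wᴴ * (z + 1)ᴴ = (z - 1)ᴴ := by
          rw [← Matrix.conjTranspose_mul, hmul']
        calc (z + 1) * (1 - w * wᴴ) * (z + 1)ᴴ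
            = (z + 1) * (z + 1)ᴴ - ((z + 1) * w) * (wᴴ * (z + 1)ᴴ) := by noncomm_ring
          _ = (2 : ℝ) • (z + zᴴ) := by
            rw [h2, hmul', two_smul]
            simp only [Matrix.conjTranspose_add, Matrix.conjTranspose_sub,
              Matrix.conjTranspose_one]
            noncomm_ring
      have key2 := conjugate_aux (M := 1 - w * wᴴ) hb
      rw [key] at key2
      refine ⟨hws, ?_, ?_⟩
      · rw [conj_aux hws, ← key2]
        rw [Matrix.mul_smul, Matrix.smul_mul, Matrix.det_smul_of_tower, Matrix.det_mul,
          Matrix.det_mul, hd]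
        simp
      · rw [conj_aux hws, ← key2]
        have := trace_aux (B := (z + 1)⁻¹) (by simp [add_comm]) hd ht' (inv_det_aux hb)
        rw [Matrix.mul_smul, Matrix.smul_mul, Matrix.trace_smul, Complex.smul_re]
        exact mul_pos two_pos this
    · intro h0
      have h3 : (1 - (z - 1) * (z + 1)⁻¹) * (z + 1) = (2 : ℂ) • 1 := by
        rw [Matrix.sub_mul, hmul, two_smul]; noncomm_ring
      have := congrArg Matrix.det h3
      rw [Matrix.det_mul, h0] at this
      norm_num at this
  · rintro w ⟨hs, hd, ht⟩ hb
    rw [conj_aux hs] at hd ht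
    have u : IsUnit (1 - w).det := isUnit_iff_ne_zero.mpr hb
    have hcomm : (1 + w) * (1 - w)⁻¹ = (1 - w)⁻¹ * (1 + w) :=
      inv_comm_aux hb (by noncomm_ring)
    have hmul : (1 + w) * (1 - w)⁻¹ * (1 - w) = 1 + w := by
      rw [Matrix.mul_assoc, Matrix.nonsing_inv_mul _ u, Matrix.mul_one]
    have hmul' : (1 - w) * ((1 + w) * (1 - w)⁻¹) = 1 + w := by
      rw [hcomm, ← Matrix.mul_assoc, Matrix.mul_nonsing_inv _ u, Matrix.one_mul]
    have hzs : ((1 + w) * (1 - w)⁻¹)ᵀ = (1 + w) * (1 - w)⁻¹ := by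
      rw [Matrix.transpose_mul, Matrix.transpose_nonsing_inv]
      simp only [Matrix.transpose_add, Matrix.transpose_sub, hs, Matrix.transpose_one]
      exact hcomm.symm
    have huniq : ∀ z ∈ lightConeTube, (z - 1) * (z + 1)⁻¹ = w → z = (1 + w) * (1 - w)⁻¹ := by
      rintro z ⟨hs', hd', ht'⟩ hw
      rw [conj_aux hs'] at hd'
      have hb' : (z + 1).det ≠ 0 := det_aux hd' (by rw [trace_add_aux]; linarith)
      have h1 : w * (z + 1) = z - 1 := by
        rw [← hw, Matrix.mul_assoc,
          Matrix.nonsing_inv_mul _ (isUnit_iff_ne_zero.mpr hb'), Matrix.mul_one]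
      have h2 : (1 - w) * z = 1 + w := by
        calc (1 - w) * z = z - w * (z + 1) + w := by noncomm_ring
          _ = 1 + w := by rw [h1]; noncomm_ring
      rw [hcomm, ← h2, ← Matrix.mul_assoc, Matrix.nonsing_inv_mul _ u, Matrix.one_mul]
    refine ⟨?_, ?_, huniq⟩
    · clear huniq
      generalize (1 + w) * (1 - w)⁻¹ = z at *
      have key : (1 - w) * (z + zᴴ) * (1 - w)ᴴ = (2 : ℝ) • (1 - w * wᴴ) := by
        have h2 : zᴴ * (1 - w)ᴴ = (1 + w)ᴴ := by
          rw [← Matrix.conjTranspose_mul, hmul']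
        calc (1 - w) * (z + zᴴ) * (1 - w)ᴴ
            = ((1 - w) * z) * (1 - w)ᴴ + (1 - w) * (zᴴ * (1 - w)ᴴ) := by noncomm_ring
          _ = (2 : ℝ) • (1 - w * wᴴ) := by
            rw [h2, hmul', two_smul]
            simp only [Matrix.conjTranspose_add, Matrix.conjTranspose_sub,
              Matrix.conjTranspose_one]
            noncomm_ring
      have key2 := conjugate_aux (M := z + zᴴ) hb
      rw [key] at key2
      refine ⟨hzs, ?_, ?_⟩
      · rw [conj_aux hzs, ← key2]
        rw [Matrix.mul_smul, Matrix.smul_mul, Matrix.det_smul_of_tower, Matrix.det_mul,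
          Matrix.det_mul, hd]
        simp
      · have h5 := trace_add_aux z
        have := trace_aux (B := (1 - w)⁻¹) (by simp) hd ht (inv_det_aux hb)
        rw [← key2, Matrix.mul_smul, Matrix.smul_mul, Matrix.trace_smul, Complex.smul_re,
          smul_eq_mul] at h5
        linarith
    · generalize (1 + w) * (1 - w)⁻¹ = z at *
      have h3 : (1 - w) * (z + 1) = (2 : ℂ) • 1 := by
        rw [Matrix.mul_add, hmul', two_smul]; noncomm_ring
      have hb' : (z + 1).det ≠ 0 := by
        intro h0
        have := congrArg Matrix.det h3
        rw [Matrix.det_mul, h0] at this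
        norm_num at this
      have h4 : z - 1 = w * (z + 1) := by
        calc z - 1 = (1 - w) * z - 1 - w + w * (z + 1) := by noncomm_ring
          _ = w * (z + 1) := by rw [hmul']; noncomm_ring
      rw [h4, Matrix.mul_assoc, Matrix.mul_nonsing_inv _ (isUnit_iff_ne_zero.mpr hb'),
        Matrix.mul_one]
end
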